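/- arXiv:1504.04195 — 3 statements merged into one kernel-verified Lean document; each statement's English description precedes it below -/
import Mathlib

section
/- Let G be a connected claw-free graph on n ≥ 18 vertices. If q(G) ≥ q(EN_n), then G is traceable, unless G is isomorphic to EN_n. -/
open SimpleGraph

/-- A graph is claw-free if it contains no induced `K_{1,3}`. -/
def ClawFree {V : Type*} (G : SimpleGraph V) : Prop :=
  ¬ ∃ v a b c : V, a ≠ b ∧ a ≠ c ∧ b ≠ c ∧
    G.Adj v a ∧ G.Adj v b ∧ G.Adj v c ∧ ¬ G.Adj a b ∧ ¬ G.Adj a c ∧ ¬ G.Adj b c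

/-- A graph is traceable if it has a Hamilton path. -/
def Traceable {V : Type*} (G : SimpleGraph V) : Prop := by
  classical
  exact ∃ (u v : V) (p : G.Walk u v), p.IsHamiltonian

/-- A graph is 2-connected if it has at least 3 vertices and deleting any
single vertex leaves a connected graph. -/
def TwoConnected {V : Type*} [Fintype V] (G : SimpleGraph V) : Prop :=
  3 ≤ Fintype.card V ∧ ∀ v : V, (G.induce ({v}ᶜ : Set V)).Connected

/-- A vertex is eligible if its neighbourhood induces a connected non-complete graph. -/
def Eligible {V : Type*} (G : SimpleGraph V) (x : V) : Prop :=
  (G.induce (G.neighborSet x)).Connected ∧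
    ∃ u v : V, G.Adj x u ∧ G.Adj x v ∧ u ≠ v ∧ ¬ G.Adj u v

/-- A claw-free graph is closed if it has no eligible vertex. -/
def IsClosedGraph {V : Type*} (G : SimpleGraph V) : Prop := ∀ x : V, ¬ Eligible G x

/-- The spectral radius of a graph: the largest eigenvalue of its adjacency matrix. -/
noncomputable def adjSpectralRadius {V : Type*} [Fintype V] (G : SimpleGraph V) : ℝ := by
  classical
  exact sSup {μ : ℝ | ∃ x : V → ℝ, x ≠ 0 ∧ (G.adjMatrix ℝ).mulVec x = μ • x}

/-- The `Q`-index of a graph: the largest eigenvalue of `Q = D + A`. -/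
noncomputable def qIndex {V : Type*} [Fintype V] (G : SimpleGraph V) : ℝ := by
  classical
  exact sSup {μ : ℝ | ∃ x : V → ℝ, x ≠ 0 ∧
    (Matrix.diagonal (fun v => (G.degree v : ℝ)) + G.adjMatrix ℝ).mulVec x = μ • x}

/-- `EN n`: the complete graph on `{0, …, n-4}` together with pendant vertices
`n-3, n-2, n-1` attached to `0, 1, 2` respectively. -/
def ENgraph (n : ℕ) : SimpleGraph (Fin n) :=
  SimpleGraph.fromRel (fun i j =>
    (i.val < n - 3 ∧ j.val < n - 3) ∨ j.val = i.val + (n - 3))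

/-- `EP n`: a clique on `{0,…,n-7}` with `a_i = i`, a triangle `b_i = n-6+i`,
and vertices `c_i = n-3+i` with edges `a_i b_i`, `a_i c_i`, `b_i c_i` (`i = 0,1,2`). -/
def EPgraph (n : ℕ) : SimpleGraph (Fin n) :=
  SimpleGraph.fromRel (fun i j =>
    (i.val < n - 6 ∧ j.val < n - 6) ∨
    (n - 6 ≤ i.val ∧ i.val < n - 3 ∧ n - 6 ≤ j.val ∧ j.val < n - 3) ∨
    (i.val < 3 ∧ (j.val = i.val + (n - 6) ∨ j.val = i.val + (n - 3))) ∨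
    (n - 6 ≤ i.val ∧ i.val < n - 3 ∧ j.val = i.val + 3))

/-- `EP' n`: a clique on `{0,…,n-7}` with `a₁ = 0`, `b₁ = 1`, `c₁ = 2`, triangles
`a₁a₂a₃` and `b₁b₂b₃` where `a₂ = n-6`, `a₃ = n-5`, `b₂ = n-4`, `b₃ = n-3`, and
vertices `c₂ = n-2`, `c₃ = n-1` with edges `a_i b_i`, `a_i c_i`, `b_i c_i` for `i = 2,3`. -/
def EP'graph (n : ℕ) : SimpleGraph (Fin n) :=
  SimpleGraph.fromRel (fun i j =>
    (i.val < n - 6 ∧ j.val < n - 6) ∨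
    (i.val = 0 ∧ (j.val = n - 6 ∨ j.val = n - 5)) ∨
    (i.val = 1 ∧ (j.val = n - 4 ∨ j.val = n - 3)) ∨
    (i.val = n - 6 ∧ (j.val = n - 5 ∨ j.val = n - 4 ∨ j.val = n - 2)) ∨
    (i.val = n - 5 ∧ (j.val = n - 3 ∨ j.val = n - 1)) ∨
    (i.val = n - 4 ∧ (j.val = n - 3 ∨ j.val = n - 2)) ∨
    (i.val = n - 3 ∧ j.val = n - 1))

section Paths

variable {V : Type*} {G : SimpleGraph V} {S T : Finset V} {a b c d u : V}

/-- `S` is the vertex set of a path of `G` from `a` to `b`. -/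
def PathOn (G : SimpleGraph V) (S : Finset V) (a b : V) : Prop :=
  ∃ l : List V, l.IsChain G.Adj ∧ l.Nodup ∧ (∀ v, v ∈ l ↔ v ∈ S) ∧
    l.head? = some a ∧ l.getLast? = some b

/-- The subgraph induced on `S` has no independent set of size three. -/
def NoIndepTriple (G : SimpleGraph V) (S : Finset V) : Prop :=
  ∀ p ∈ S, ∀ q ∈ S, ∀ t ∈ S, p ≠ q → p ≠ t → q ≠ t → G.Adj p q ∨ G.Adj p t ∨ G.Adj q t

/-- Every proper nonempty subset of `S` is joined by an edge to its complement in `S`. -/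
def CutConnected (G : SimpleGraph V) (S : Finset V) : Prop :=
  ∀ C ⊆ S, C.Nonempty → C ≠ S → ∃ w ∈ C, ∃ v ∈ S, v ∉ C ∧ G.Adj w v

/-- Any two distinct vertices of `S` are adjacent. -/
def CliqueOn (G : SimpleGraph V) (S : Finset V) : Prop :=
  ∀ p ∈ S, ∀ q ∈ S, p ≠ q → G.Adj p q

theorem CliqueOn.mono (h : CliqueOn G T) (hST : S ⊆ T) : CliqueOn G S :=
  fun p hp q hq => h p (hST hp) q (hST hq)

theorem NoIndepTriple.mono (h : NoIndepTriple G T) (hST : S ⊆ T) : NoIndepTriple G S :=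
  fun p hp q hq t ht => h p (hST hp) q (hST hq) t (hST ht)

theorem PathOn.singleton (a : V) : PathOn G {a} a a :=
  ⟨[a], by simp, by simp, by simp, by simp, by simp⟩

theorem PathOn.symm (h : PathOn G S a b) : PathOn G S b a := by
  obtain ⟨l, hc, hn, hm, hh, hl⟩ := h
  refine ⟨l.reverse, ?_, by simpa, by simpa, by simpa, by simpa⟩
  rw [List.isChain_reverse]
  exact hc.imp fun _ _ h => h.symm

theorem PathOn.append [DecidableEq V] (h : PathOn G S a b) (h' : PathOn G T c d)
    (hbc : G.Adj b c) (hST : Disjoint S T) : PathOn G (S ∪ T) a d := by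
  obtain ⟨l, hc, hn, hm, hh, hl⟩ := h
  obtain ⟨l', hc', hn', hm', hh', hl'⟩ := h'
  refine ⟨l ++ l', ?_, ?_, by simp [hm, hm'], by simp [hh], by simp [hl']⟩
  · rw [List.isChain_append]
    refine ⟨hc, hc', ?_⟩
    simp [hl, hh', hbc]
  · rw [List.nodup_append]
    refine ⟨hn, hn', fun x hx y hy hxy => ?_⟩
    exact Finset.disjoint_left.1 hST ((hm x).1 hx) (hxy ▸ (hm' y).1 hy)

theorem PathOn.cons [DecidableEq V] (h : PathOn G S a b) (hu : G.Adj u a) (huS : u ∉ S) :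
    PathOn G (insert u S) u b := by
  have := (PathOn.singleton u).append h hu (by simpa)
  rwa [← Finset.insert_eq] at this

theorem PathOn.concat [DecidableEq V] (h : PathOn G S a b) (hu : G.Adj b u) (huS : u ∉ S) :
    PathOn G (insert u S) a u :=
  (h.symm.cons hu.symm huS).symm

theorem PathOn.traceable [Fintype V] (h : PathOn G S a b) (hS : ∀ v, v ∈ S) : Traceable G := by
  classical
  obtain ⟨l, hc, hn, hm, hh, hl⟩ := h
  have hne : l ≠ [] := by rintro rfl; simp at hh
  refine ⟨_, _, Walk.ofSupport l hne hc, fun v => ?_⟩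
  rw [Walk.support_ofSupport]
  convert List.count_eq_one_of_mem hn ((hm v).2 (hS v))

theorem CliqueOn.pathOn [DecidableEq V] (h : CliqueOn G S) (ha : a ∈ S) (hb : b ∈ S)
    (hab : a ≠ b) : PathOn G S a b := by
  have hl : ((S.erase a).erase b).toList.Pairwise G.Adj := by
    have := ((S.erase a).erase b).nodup_toList
    refine List.Pairwise.imp_of_mem ?_ this
    intro p q hp hq hpq
    simp only [Finset.mem_toList, Finset.mem_erase] at hp hq
    exact h p hp.2.2 q hq.2.2 hpq
  refine ⟨a :: (((S.erase a).erase b).toList ++ [b]), ?_, ?_, ?_, by simp, ?_⟩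
  · apply List.Pairwise.isChain
    rw [List.pairwise_cons, List.pairwise_append]
    refine ⟨?_, hl, by simp, ?_⟩
    · intro x hx
      simp at hx
      rcases hx with hx | rfl
      · exact h a ha x hx.2.2 (Ne.symm hx.2.1)
      · exact h a ha x hb hab
    · intro x hx y hy
      simp at hx hy
      subst hy
      exact h x hx.2.2 y hb hx.1
  · rw [List.nodup_cons, List.nodup_append]
    refine ⟨by simp [hab], Finset.nodup_toList _, by simp, ?_⟩
    intro x hx y hy
    simp at hx hy
    subst hy
    exact hx.1
  · intro v
    simp only [List.mem_cons, List.mem_append, Finset.mem_toList, Finset.mem_erase,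
      List.not_mem_nil, or_false]
    grind
  · simp [List.getLast?_cons]

theorem CliqueOn.exists_pathOn [DecidableEq V] (h : CliqueOn G S) (ha : a ∈ S) :
    ∃ b ∈ S, PathOn G S a b := by
  by_cases hS : S = {a}
  · exact ⟨a, ha, hS ▸ PathOn.singleton a⟩
  · obtain ⟨b, hb, hab⟩ : ∃ b ∈ S, b ≠ a := by
      by_contra! hcon
      exact hS (Finset.eq_singleton_iff_unique_mem.2 ⟨ha, hcon⟩)
    exact ⟨b, hb, h.pathOn ha hb hab.symm⟩

/-- In a connected graph with independence number at most two, two disjoint paths, one starting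
at `a` and the other ending at `b`, can be made to cover any number of vertices. -/
theorem exists_two_paths_length (hα : NoIndepTriple G S) (hc : CutConnected G S)
    (ha : a ∈ S) (hb : b ∈ S) (hab : a ≠ b) (k : ℕ) (hk : 2 ≤ k) (hkS : k ≤ S.card) :
    ∃ P Q : List V, P.IsChain G.Adj ∧ Q.IsChain G.Adj ∧ (P ++ Q).Nodup ∧
      (∀ v ∈ P ++ Q, v ∈ S) ∧ P.head? = some a ∧ Q.getLast? = some b ∧
      (P ++ Q).length = k := by
  classical
  induction k, hk using Nat.le_induction with
  | base => exact ⟨[a], [b], by simp, by simp, by simpa, by simp [ha, hb], by simp, by simp, rfl⟩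
  | succ k hk ih =>
    obtain ⟨P, Q, hP, hQ, hn, hS, hPa, hQb, hlen⟩ := ih (by omega)
    have hPa' : a ∈ P := List.mem_of_head? hPa
    have hcard : (P ++ Q).toFinset.card = k := by rw [List.toFinset_card_of_nodup hn, hlen]
    obtain ⟨w, hw, v, hvS, hv, hwv⟩ := hc (P ++ Q).toFinset
      (fun v hv => hS v (List.mem_toFinset.1 hv)) ⟨a, by simp [hPa']⟩
      (by intro h; rw [h] at hcard; omega)
    rw [List.mem_toFinset] at hw hv
    obtain ⟨p, hp⟩ : ∃ p, P.getLast? = some p := by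
      rcases P.eq_nil_or_concat with rfl | ⟨P', x, rfl⟩ <;> simp_all
    obtain ⟨q, hq⟩ : ∃ q, Q.head? = some q := by
      rcases Q with _ | ⟨x, Q'⟩ <;> simp_all
    have hp' : p ∈ P := List.mem_of_getLast? hp
    have hq' : q ∈ Q := List.mem_of_head? hq
    by_cases hpv : G.Adj p v
    · refine ⟨P ++ [v], Q, ?_, hQ, ?_, ?_, by simp [hPa], hQb, by simp at hlen ⊢; omega⟩
      · rw [List.isChain_append]
        exact ⟨hP, by simp, by simp [hp, hpv]⟩
      · have : (P ++ [v] ++ Q).Perm (v :: (P ++ Q)) := by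
          simp [List.perm_middle]
        rw [this.nodup_iff, List.nodup_cons]
        exact ⟨hv, hn⟩
      · intro x hx
        simp at hx
        rcases hx with hx | rfl | hx
        · exact hS x (by simp [hx])
        · exact hvS
        · exact hS x (by simp [hx])
    by_cases hqv : G.Adj q v
    · refine ⟨P, v :: Q, hP, ?_, ?_, ?_, hPa, ?_, by simp at hlen ⊢; omega⟩
      · rcases Q with _ | ⟨x, Q'⟩
        · simp
        · simp at hq
          subst hq
          exact List.isChain_cons_cons.2 ⟨hqv.symm, hQ⟩
      · rw [List.perm_middle.nodup_iff, List.nodup_cons]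
        exact ⟨hv, hn⟩
      · intro x hx
        simp at hx
        rcases hx with hx | rfl | hx
        · exact hS x (by simp [hx])
        · exact hvS
        · exact hS x (by simp [hx])
      · rw [List.getLast?_cons, hQb]; simp
    have hpq : G.Adj p q := by
      have hpv' : p ≠ v := fun h => hv (by simp [← h, hp'])
      have hqv' : q ≠ v := fun h => hv (by simp [← h, hq'])
      have hpq' : p ≠ q := (List.nodup_append.1 hn).2.2 p hp' q hq'
      rcases hα p (hS p (by simp [hp'])) q (hS q (by simp [hq'])) v hvS hpq' hpv' hqv' with
        h | h | h
      · exact h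
      · exact absurd h hpv
      · exact absurd h hqv
    have hPQ : (P ++ Q).IsChain G.Adj := by
      rw [List.isChain_append]
      exact ⟨hP, hQ, by simp [hp, hq, hpq]⟩
    have hPQa : (P ++ Q).head? = some a := by simp [hPa]
    have hPQb : (P ++ Q).getLast? = some b := by simp [hQb]
    obtain ⟨s, t, hst⟩ := List.append_of_mem hw
    rw [hst] at hPQ hPQa hPQb hn hS hv hlen
    rcases t with _ | ⟨t0, t⟩
    · have hwb : w = b := by simpa using hPQb
      subst hwb
      refine ⟨s, [v, w], (List.isChain_append.1 hPQ).1, ?_, ?_, ?_, ?_, by simp,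
        by simp at hlen ⊢; omega⟩
      · simpa using hwv.symm
      · rw [List.perm_middle.nodup_iff, List.nodup_cons]
        exact ⟨hv, hn⟩
      · intro x hx
        simp at hx
        rcases hx with hx | rfl | rfl
        · exact hS x (by simp [hx])
        · exact hvS
        · exact hS x (by simp)
      · rcases s with _ | ⟨s0, s⟩
        · simp at hPQa
          exact absurd hPQa.symm hab
        · simpa using hPQa
    · have hsplit : (s ++ [w] ++ (t0 :: t)).IsChain G.Adj := by simpa using hPQ
      rw [List.isChain_append] at hsplit
      refine ⟨s ++ [w] ++ [v], t0 :: t, ?_, hsplit.2.1, ?_, ?_, ?_, ?_,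
        by simp at hlen ⊢; omega⟩
      · rw [List.isChain_append]
        exact ⟨hsplit.1, by simp, by simp [hwv]⟩
      · have : (s ++ [w] ++ [v] ++ t0 :: t).Perm (v :: (s ++ w :: t0 :: t)) := by
          have := List.perm_middle (a := v) (l₁ := s ++ [w]) (l₂ := t0 :: t)
          simpa using this
        rw [this.nodup_iff, List.nodup_cons]
        exact ⟨hv, hn⟩
      · intro x hx
        by_cases hxv : x = v
        · exact hxv ▸ hvS
        · apply hS
          simp at hx ⊢
          tauto
      · rcases s with _ | ⟨s0, s⟩ <;> simpa using hPQa
      · simpa using hPQb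

/-- A cone over a connected graph with independence number at most two has a Hamilton path
between any two vertices of the base. -/
theorem CutConnected.pathOn_insert [DecidableEq V] (hc : CutConnected G S)
    (hα : NoIndepTriple G S) (ha : a ∈ S) (hb : b ∈ S) (hab : a ≠ b)
    (hu : ∀ s ∈ S, G.Adj u s) : PathOn G (insert u S) a b := by
  have h2 : 2 ≤ S.card := by
    have := Finset.one_lt_card.2 ⟨a, ha, b, hb, hab⟩
    omega
  obtain ⟨P, Q, hP, hQ, hn, hS, hPa, hQb, hlen⟩ :=
    exists_two_paths_length hα hc ha hb hab _ h2 le_rfl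
  have hPQ : (P ++ Q).toFinset = S :=
    Finset.eq_of_subset_of_card_le (fun v hv => hS v (List.mem_toFinset.1 hv))
      (by rw [List.toFinset_card_of_nodup hn, hlen])
  have huS : u ∉ P ++ Q := fun h => (hu u (hS u h)).ne rfl
  refine ⟨P ++ u :: Q, ?_, ?_, ?_, by simp [hPa], by simp [List.getLast?_cons, hQb]⟩
  · rw [List.isChain_append]
    refine ⟨hP, ?_, ?_⟩
    · rcases Q with _ | ⟨x, Q'⟩
      · simp
      · exact List.isChain_cons_cons.2 ⟨hu x (hS x (by simp)), hQ⟩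
    · intro x hx y hy
      simp at hy
      subst hy
      exact (hu x (hS x (by simp [List.mem_of_getLast? hx]))).symm
  · rw [List.perm_middle.nodup_iff, List.nodup_cons]
    exact ⟨huS, hn⟩
  · intro v
    rw [List.perm_middle.mem_iff, Finset.mem_insert, ← hPQ, List.mem_toFinset, List.mem_cons]

end Paths

section Spectral

variable {V : Type*} [Fintype V]

/-- The signless Laplacian matrix `D + A`. -/
def signlessLapMatrix [DecidableEq V] (G : SimpleGraph V) [DecidableRel G.Adj] : Matrix V V ℝ :=
  Matrix.diagonal (fun v => (G.degree v : ℝ)) + G.adjMatrix ℝ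

theorem signlessLapMatrix_mulVec_apply [DecidableEq V] (G : SimpleGraph V) [DecidableRel G.Adj]
    (x : V → ℝ) (v : V) :
    (signlessLapMatrix G).mulVec x v = G.degree v * x v + ∑ w ∈ G.neighborFinset v, x w := by
  simp [signlessLapMatrix, Matrix.add_mulVec, Matrix.mulVec_diagonal]

theorem isHermitian_signlessLapMatrix [DecidableEq V] (G : SimpleGraph V) [DecidableRel G.Adj] :
    (signlessLapMatrix G).IsHermitian := by
  apply Matrix.IsHermitian.add
  · rw [Matrix.isHermitian_diagonal_iff]
    intro i
    simp [IsSelfAdjoint]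
  · ext i j
    simp [Matrix.conjTranspose_apply, adjMatrix_apply, G.adj_comm]

theorem qIndex_eq [DecidableEq V] (G : SimpleGraph V) [DecidableRel G.Adj] :
    qIndex G = sSup {μ : ℝ | ∃ x : V → ℝ, x ≠ 0 ∧ (signlessLapMatrix G).mulVec x = μ • x} := by
  unfold qIndex signlessLapMatrix
  congr!

/-- An eigenvalue of the signless Laplacian of a graph without isolated vertices is at most
the degree of some vertex plus the average degree of its neighbours. -/
theorem exists_le_degree_add_avg [DecidableEq V] (G : SimpleGraph V) [DecidableRel G.Adj]
    (hdeg : ∀ v, 0 < G.degree v) {μ : ℝ} {x : V → ℝ} (hx : x ≠ 0)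
    (h : (signlessLapMatrix G).mulVec x = μ • x) :
    ∃ u, μ * G.degree u ≤ G.degree u * G.degree u + ∑ w ∈ G.neighborFinset u, (G.degree w : ℝ) := by
  obtain ⟨v₀, hv₀⟩ := Function.ne_iff.1 hx
  have : Nonempty V := ⟨v₀⟩
  obtain ⟨u, hu⟩ := Finite.exists_max fun v => |x v| / G.degree v
  have hd : ∀ v, (0 : ℝ) < G.degree v := fun v => by exact_mod_cast hdeg v
  set c := |x u| / G.degree u with hc
  have hxc : ∀ v, |x v| ≤ c * G.degree v := fun v => (div_le_iff₀ (hd v)).1 (hu v)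
  have hxu : |x u| = c * G.degree u := by rw [hc]; field_simp [(hd u).ne']
  have hcpos : 0 < c := lt_of_lt_of_le (div_pos (abs_pos.2 hv₀) (hd v₀)) (hu v₀)
  refine ⟨u, ?_⟩
  have he := congrFun h u
  rw [signlessLapMatrix_mulVec_apply, Pi.smul_apply, smul_eq_mul] at he
  have h1 : μ * |x u| ≤ G.degree u * |x u| + ∑ w ∈ G.neighborFinset u, |x w| := by
    calc μ * |x u| ≤ |μ * x u| := by
          rw [abs_mul]; exact mul_le_mul_of_nonneg_right (le_abs_self _) (abs_nonneg _)
      _ ≤ |G.degree u * x u| + |∑ w ∈ G.neighborFinset u, x w| := by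
          rw [← he]; exact abs_add_le _ _
      _ ≤ _ := by
          rw [abs_mul, abs_of_pos (hd u)]
          exact add_le_add le_rfl (Finset.abs_sum_le_sum_abs _ _)
  have h2 : ∑ w ∈ G.neighborFinset u, |x w| ≤
      c * ∑ w ∈ G.neighborFinset u, (G.degree w : ℝ) := by
    rw [Finset.mul_sum]
    exact Finset.sum_le_sum fun w _ => hxc w
  rw [hxu] at h1
  refine le_of_mul_le_mul_left ?_ hcpos
  linarith

theorem bddAbove_eigenvalues [DecidableEq V] (G : SimpleGraph V) [DecidableRel G.Adj] :
    BddAbove {μ : ℝ | ∃ x : V → ℝ, x ≠ 0 ∧ (signlessLapMatrix G).mulVec x = μ • x} := by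
  refine ⟨Fintype.card V + Fintype.card V, ?_⟩
  rintro μ ⟨x, hx, h⟩
  obtain ⟨v₀, hv₀⟩ := Function.ne_iff.1 hx
  have : Nonempty V := ⟨v₀⟩
  obtain ⟨u, hu⟩ := Finite.exists_max fun v => |x v|
  have hpos : 0 < |x u| := lt_of_lt_of_le (abs_pos.2 hv₀) (hu v₀)
  have hd : (G.degree u : ℝ) ≤ Fintype.card V := by exact_mod_cast (G.degree_lt_card_verts u).le
  have he := congrFun h u
  rw [signlessLapMatrix_mulVec_apply, Pi.smul_apply, smul_eq_mul] at he
  have h1 : μ * |x u| ≤ G.degree u * |x u| + ∑ w ∈ G.neighborFinset u, |x w| := by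
    calc μ * |x u| ≤ |μ * x u| := by
          rw [abs_mul]; exact mul_le_mul_of_nonneg_right (le_abs_self _) (abs_nonneg _)
      _ ≤ |G.degree u * x u| + |∑ w ∈ G.neighborFinset u, x w| := by
          rw [← he]; exact abs_add_le _ _
      _ ≤ _ := by
          rw [abs_mul, abs_of_nonneg (Nat.cast_nonneg _)]
          exact add_le_add le_rfl (Finset.abs_sum_le_sum_abs _ _)
  have h2 : ∑ w ∈ G.neighborFinset u, |x w| ≤ G.degree u * |x u| := by
    have := Finset.sum_le_card_nsmul (G.neighborFinset u) (fun w => |x w|) |x u| fun w _ => hu w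
    simpa using this
  have h3 : (G.degree u : ℝ) * |x u| ≤ Fintype.card V * |x u| :=
    mul_le_mul_of_nonneg_right hd hpos.le
  refine le_of_mul_le_mul_right ?_ hpos
  linarith

/-- The Rayleigh principle for the signless Laplacian. -/
theorem rayleigh_le_qIndex [DecidableEq V] (G : SimpleGraph V) [DecidableRel G.Adj] (x : V → ℝ) :
    x ⬝ᵥ (signlessLapMatrix G).mulVec x ≤ qIndex G * (x ⬝ᵥ x) := by
  have hH : (qIndex G • (1 : Matrix V V ℝ) - signlessLapMatrix G).IsHermitian := by
    refine Matrix.IsHermitian.sub ?_ (isHermitian_signlessLapMatrix G)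
    ext i j
    simp [Matrix.conjTranspose_apply, Matrix.one_apply, eq_comm]
  have hP := (hH.posSemidef_iff_eigenvalues_nonneg).2 fun i => by
    have he := hH.mulVec_eigenvectorBasis i
    have hne : (hH.eigenvectorBasis i : V → ℝ) ≠ 0 := by
      intro h
      apply hH.eigenvectorBasis.orthonormal.ne_zero i
      ext j
      exact congrFun h j
    have hmem : qIndex G - hH.eigenvalues i ≤ qIndex G := by
      refine (le_csSup (bddAbove_eigenvalues G) ⟨_, hne, ?_⟩).trans_eq (qIndex_eq G).symm
      rw [Matrix.sub_mulVec, Matrix.smul_mulVec, Matrix.one_mulVec] at he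
      rw [sub_smul, ← he]
      abel
    simpa using hmem
  have := hP.dotProduct_mulVec_nonneg x
  rw [Matrix.sub_mulVec, Matrix.smul_mulVec, Matrix.one_mulVec] at this
  simp only [star_trivial, dotProduct_sub, dotProduct_smul, smul_eq_mul] at this
  linarith

theorem le_qIndex_ENgraph (n : ℕ) (hn : 7 ≤ n) :
    2 * (n : ℝ) - 8 + 3 / (n - 3) ≤ qIndex (ENgraph n) := by
  classical
  set s : Finset (Fin n) := Finset.univ.filter fun i => i.val < n - 3 with hs
  have hscard : s.card = n - 3 := by
    rw [hs, Fin.card_filter_val_lt]; omega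
  set x : Fin n → ℝ := fun i => if i ∈ s then 1 else 0 with hx
  have hadj : ∀ i j : Fin n, i ∈ s → j ∈ s → i ≠ j → (ENgraph n).Adj i j := by
    intro i j hi hj hij
    simp only [hs, Finset.mem_filter, Finset.mem_univ, true_and] at hi hj
    exact ⟨hij, Or.inl (Or.inl ⟨hi, hj⟩)⟩
  have hsub : ∀ i ∈ s, s.erase i ⊆ (ENgraph n).neighborFinset i := by
    intro i hi j hj
    rw [Finset.mem_erase] at hj
    exact (mem_neighborFinset _ _ _).2 (hadj i j hi hj.2 hj.1.symm)
  have hdeg : ∀ i ∈ s, n - 4 ≤ (ENgraph n).degree i := by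
    intro i hi
    rw [← card_neighborFinset_eq_degree]
    have := Finset.card_le_card (hsub i hi)
    rw [Finset.card_erase_of_mem hi, hscard] at this
    omega
  have hdeg' : ∀ i ∈ s, i.val < 3 → n - 3 ≤ (ENgraph n).degree i := by
    intro i hi hi3
    rw [← card_neighborFinset_eq_degree]
    set j : Fin n := ⟨i.val + (n - 3), by omega⟩ with hj
    have hjs : j ∉ s := by simp [hs, hj]
    have h1 : insert j (s.erase i) ⊆ (ENgraph n).neighborFinset i := by
      rw [Finset.insert_subset_iff]
      refine ⟨(mem_neighborFinset _ _ _).2 ⟨?_, Or.inl (Or.inr rfl)⟩, hsub i hi⟩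
      intro h
      have := congrArg Fin.val h
      simp [hj] at this
      omega
    have := Finset.card_le_card h1
    rw [Finset.card_insert_of_notMem (fun h => hjs (Finset.mem_of_mem_erase h)),
      Finset.card_erase_of_mem hi, hscard] at this
    omega
  have hsum : ∀ i ∈ s, ((n : ℝ) - 4) ≤ ∑ w ∈ (ENgraph n).neighborFinset i, x w := by
    intro i hi
    calc ((n : ℝ) - 4) = ∑ w ∈ s.erase i, x w := by
          rw [Finset.sum_congr rfl (fun w hw => if_pos (Finset.mem_of_mem_erase hw)),
            Finset.sum_const, Finset.card_erase_of_mem hi, hscard, nsmul_eq_mul, mul_one]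
          have h4 : n - 3 - 1 + 4 = n := by omega
          have h5 : ((n - 3 - 1 : ℕ) : ℝ) + 4 = n := by exact_mod_cast h4
          linarith
      _ ≤ _ := Finset.sum_le_sum_of_subset_of_nonneg (hsub i hi) fun w _ _ => by
          simp only [hx]; split_ifs <;> norm_num
  have hlow : ∀ i ∈ s, (2 * (n : ℝ) - 8) + (if i.val < 3 then 1 else 0) ≤
      (signlessLapMatrix (ENgraph n)).mulVec x i := by
    intro i hi
    rw [signlessLapMatrix_mulVec_apply]
    have hxi : x i = 1 := if_pos hi
    rw [hxi, mul_one]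
    have := hsum i hi
    split_ifs with h3
    · have h := hdeg' i hi h3
      have h' : (n : ℝ) ≤ (ENgraph n).degree i + 3 := by exact_mod_cast (by omega)
      linarith
    · have h := hdeg i hi
      have h' : (n : ℝ) ≤ (ENgraph n).degree i + 4 := by exact_mod_cast (by omega)
      linarith
  have hcount : (s.filter fun i : Fin n => i.val < 3).card = 3 := by
    have : (s.filter fun i : Fin n => i.val < 3) = Finset.univ.filter fun i : Fin n => i.val < 3 := by
      ext i; simp only [hs, Finset.mem_filter, Finset.mem_univ, true_and]; omega
    rw [this, Fin.card_filter_val_lt]; omega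
  have hn3 : ((n - 3 : ℕ) : ℝ) = (n : ℝ) - 3 := by
    have h4 : n - 3 + 3 = n := by omega
    have h5 : ((n - 3 : ℕ) : ℝ) + 3 = n := by exact_mod_cast h4
    linarith
  have hquad : ((n : ℝ) - 3) * (2 * n - 8) + 3 ≤
      x ⬝ᵥ (signlessLapMatrix (ENgraph n)).mulVec x := by
    calc ((n : ℝ) - 3) * (2 * n - 8) + 3
        = ∑ i ∈ s, ((2 * (n : ℝ) - 8) + (if i.val < 3 then 1 else 0)) := by
          rw [Finset.sum_add_distrib, Finset.sum_const, hscard, nsmul_eq_mul, hn3,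
            Finset.sum_boole, hcount]
          norm_num
      _ ≤ ∑ i ∈ s, (signlessLapMatrix (ENgraph n)).mulVec x i := Finset.sum_le_sum hlow
      _ = _ := by simp [dotProduct, hx]
  have hnorm : x ⬝ᵥ x = (n : ℝ) - 3 := by
    simp [dotProduct, hx, hscard, hn3]
  have hR := rayleigh_le_qIndex (ENgraph n) x
  rw [hnorm] at hR
  have hpos : (0 : ℝ) < n - 3 := by
    have : (7 : ℝ) ≤ n := by exact_mod_cast hn
    linarith
  refine le_of_mul_le_mul_right ?_ hpos
  rw [add_mul, div_mul_cancel₀ _ hpos.ne']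
  linarith

/-- A graph whose `Q`-index is at least that of `ENgraph n` has a vertex of large degree whose
neighbours have large average degree. -/
theorem exists_large_neighborhood [DecidableEq V] (G : SimpleGraph V) [DecidableRel G.Adj] (n : ℕ)
    (hn : 13 ≤ n) (hcard : Fintype.card V = n) (hdeg : ∀ v, 0 < G.degree v)
    (hq : qIndex (ENgraph n) ≤ qIndex G) :
    ∃ u, n ≤ G.degree u + 6 ∧ G.degree u * (2 * n) + 3 ≤
      G.degree u * (G.degree u + 8) + ∑ w ∈ G.neighborFinset u, G.degree w := by
  have hnR : (13 : ℝ) ≤ n := by exact_mod_cast hn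
  have hlt : 2 * (n : ℝ) - 8 + 2 / (n - 6) < qIndex G := by
    refine lt_of_lt_of_le ?_ ((le_qIndex_ENgraph n (by omega)).trans hq)
    have : (2 : ℝ) / (n - 6) < 3 / (n - 3) := by
      rw [div_lt_div_iff₀ (by linarith) (by linarith)]
      linarith
    linarith
  have hne : {μ : ℝ | ∃ x : V → ℝ, x ≠ 0 ∧ (signlessLapMatrix G).mulVec x = μ • x}.Nonempty := by
    by_contra hemp
    rw [Set.not_nonempty_iff_eq_empty] at hemp
    rw [qIndex_eq G, hemp, Real.sSup_empty] at hlt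
    have : (0 : ℝ) ≤ 2 / (n - 6) := div_nonneg (by norm_num) (by linarith)
    linarith
  rw [qIndex_eq G] at hlt
  obtain ⟨μ, ⟨x, hx, h⟩, hμ⟩ := exists_lt_of_lt_csSup hne hlt
  obtain ⟨u, hu⟩ := exists_le_degree_add_avg G hdeg hx h
  have hd : (0 : ℝ) < G.degree u := by exact_mod_cast hdeg u
  have hfrac : (0 : ℝ) < 2 / (n - 6) := div_pos (by norm_num) (by linarith)
  have hdn : n ≤ G.degree u + 6 := by
    have h1 : ∑ w ∈ G.neighborFinset u, (G.degree w : ℝ) ≤ G.degree u * ((n : ℝ) - 1) := by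
      have := Finset.sum_le_card_nsmul (G.neighborFinset u) (fun w => (G.degree w : ℝ))
        ((n : ℝ) - 1) fun w _ => by
          have h2 := G.degree_lt_card_verts w
          rw [hcard] at h2
          have h3 : (G.degree w : ℝ) + 1 ≤ n := by exact_mod_cast h2
          linarith
      simpa using this
    have h2 : μ * G.degree u ≤ (G.degree u + ((n : ℝ) - 1)) * G.degree u := by linarith
    have h3 := le_of_mul_le_mul_right h2 hd
    have h4 : (n : ℝ) < G.degree u + 7 := by linarith
    have h5 : n < G.degree u + 7 := by exact_mod_cast h4
    omega
  refine ⟨u, hdn, ?_⟩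
  have hdnR : (n : ℝ) - 6 ≤ G.degree u := by
    have : (n : ℝ) ≤ G.degree u + 6 := by exact_mod_cast hdn
    linarith
  have h1 : (2 * (n : ℝ) - 8 + 2 / (n - 6)) * G.degree u < μ * G.degree u :=
    mul_lt_mul_of_pos_right hμ hd
  have h2 : 2 ≤ 2 / ((n : ℝ) - 6) * G.degree u := by
    rw [div_mul_eq_mul_div, le_div_iff₀ (by linarith)]
    linarith
  have h3 : (G.degree u : ℝ) * (2 * n) + 2 <
      G.degree u * (G.degree u + 8) + ∑ w ∈ G.neighborFinset u, (G.degree w : ℝ) := by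
    linarith
  have h4 : G.degree u * (2 * n) + 2 <
      G.degree u * (G.degree u + 8) + ∑ w ∈ G.neighborFinset u, G.degree w := by
    exact_mod_cast h3
  omega

end Spectral

section Structure

variable {V : Type*} [Fintype V] [DecidableEq V] {G : SimpleGraph V} [DecidableRel G.Adj]

/-- The vertices different from `u` and not adjacent to `u`. -/
def outer (G : SimpleGraph V) [DecidableRel G.Adj] (u : V) : Finset V :=
  Finset.univ.filter fun v => v ≠ u ∧ ¬ G.Adj u v

/-- The number of neighbours of `u` that are different from `w` and not adjacent to `w`. -/
def missing (G : SimpleGraph V) [DecidableRel G.Adj] (u w : V) : ℕ :=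
  ((G.neighborFinset u).filter fun v => v ≠ w ∧ ¬ G.Adj w v).card

/-- The number of neighbours of `w` in `outer G u`. -/
def outerDegree (G : SimpleGraph V) [DecidableRel G.Adj] (u w : V) : ℕ :=
  ((outer G u).filter fun v => G.Adj w v).card

theorem mem_outer {u v : V} : v ∈ outer G u ↔ v ≠ u ∧ ¬ G.Adj u v := by
  simp [outer]

theorem mem_outer_or (u v : V) : v ∈ outer G u ∨ v = u ∨ v ∈ G.neighborFinset u := by
  rw [mem_outer, mem_neighborFinset]; tauto

theorem disjoint_outer (u : V) : Disjoint (outer G u) (insert u (G.neighborFinset u)) := by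
  rw [Finset.disjoint_left]
  intro v hv
  rw [mem_outer] at hv
  simp [hv.1, hv.2]

theorem card_eq_degree_add (u : V) :
    Fintype.card V = G.degree u + 1 + (outer G u).card := by
  have h : outer G u ∪ insert u (G.neighborFinset u) = Finset.univ := by
    ext v
    have := mem_outer_or (G := G) u v
    simp only [Finset.mem_union, Finset.mem_insert, Finset.mem_univ, iff_true]
    exact this
  rw [← Finset.card_univ, ← h, Finset.card_union_of_disjoint (disjoint_outer u),
    Finset.card_insert_of_notMem (by simp), card_neighborFinset_eq_degree]
  omega

theorem degree_add_missing {u w : V} (hw : G.Adj u w) :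
    G.degree w + missing G u w = G.degree u + outerDegree G u w := by
  have h1 : G.neighborFinset w =
      insert u ((G.neighborFinset u).filter (G.Adj w) ∪ (outer G u).filter (G.Adj w)) := by
    ext v
    have := mem_outer_or (G := G) u v
    simp only [mem_neighborFinset, Finset.mem_insert, Finset.mem_union, Finset.mem_filter] at this ⊢
    constructor
    · tauto
    · rintro (rfl | h | h)
      · exact hw.symm
      · exact h.2
      · exact h.2
  have h2 : G.neighborFinset u = insert w ((G.neighborFinset u).filter (G.Adj w) ∪
      (G.neighborFinset u).filter fun v => v ≠ w ∧ ¬ G.Adj w v) := by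
    ext v
    simp only [mem_neighborFinset, Finset.mem_insert, Finset.mem_union, Finset.mem_filter]
    constructor
    · tauto
    · rintro (rfl | h | h)
      · exact hw
      · exact h.1
      · exact h.1
  have h3 : G.degree w = 1 + (((G.neighborFinset u).filter (G.Adj w)).card +
      outerDegree G u w) := by
    rw [← card_neighborFinset_eq_degree, h1, Finset.card_insert_of_notMem,
      Finset.card_union_of_disjoint, outerDegree, add_comm]
    · rw [Finset.disjoint_left]
      intro v hv hv'
      simp only [Finset.mem_filter, mem_outer, mem_neighborFinset] at hv hv'
      exact hv'.1.2 hv.1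
    · simp [mem_outer]
  have h4 : G.degree u = 1 + (((G.neighborFinset u).filter (G.Adj w)).card +
      missing G u w) := by
    conv_lhs => rw [← card_neighborFinset_eq_degree, h2]
    rw [Finset.card_insert_of_notMem, Finset.card_union_of_disjoint, missing, add_comm]
    · rw [Finset.disjoint_left]
      intro v hv hv'
      simp only [Finset.mem_filter] at hv hv'
      exact hv'.2.2 hv.2
    · simp
  omega

theorem sum_degree_add_sum_missing (u : V) :
    ∑ w ∈ G.neighborFinset u, G.degree w + ∑ w ∈ G.neighborFinset u, missing G u w =
      G.degree u * G.degree u + ∑ w ∈ G.neighborFinset u, outerDegree G u w := by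
  rw [← Finset.sum_add_distrib, Finset.sum_congr rfl
    (fun w hw => degree_add_missing ((mem_neighborFinset _ _ _).1 hw)), Finset.sum_add_distrib,
    Finset.sum_const, card_neighborFinset_eq_degree, smul_eq_mul]

theorem SimpleGraph.Connected.exists_adj_crossing {V : Type*} {G : SimpleGraph V}
    (hconn : G.Connected) {S : Finset V}
    (hS : S.Nonempty) {t : V} (ht : t ∉ S) : ∃ a ∈ S, ∃ b ∉ S, G.Adj a b := by
  obtain ⟨s, hs⟩ := hS
  obtain ⟨p⟩ := hconn.preconnected s t
  obtain ⟨e, -, h1, h2⟩ := p.exists_boundary_dart (S : Set V) hs ht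
  exact ⟨e.fst, h1, e.snd, h2, e.adj⟩

theorem ClawFree.exists_adj {V : Type*} {G : SimpleGraph V} (h : ClawFree G) {v a b c : V}
    (hab : a ≠ b) (hac : a ≠ c) (hbc : b ≠ c) (ha : G.Adj v a) (hb : G.Adj v b)
    (hc : G.Adj v c) : G.Adj a b ∨ G.Adj a c ∨ G.Adj b c := by
  by_contra hcon
  push Not at hcon
  exact h ⟨v, a, b, c, hab, hac, hbc, ha, hb, hc, hcon.1, hcon.2.1, hcon.2.2⟩

theorem ClawFree.noIndepTriple {V : Type*} [Fintype V] {G : SimpleGraph V} [DecidableRel G.Adj]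
    (h : ClawFree G) (u : V) :
    NoIndepTriple G (G.neighborFinset u) := by
  intro p hp q hq t ht hpq hpt hqt
  rw [mem_neighborFinset] at hp hq ht
  exact h.exists_adj hpq hpt hqt hp hq ht

theorem ClawFree.adj_of_outer (h : ClawFree G) {u w x y : V} (hw : G.Adj u w)
    (hx : x ∈ outer G u) (hy : y ∈ outer G u) (hxy : x ≠ y) (hwx : G.Adj w x)
    (hwy : G.Adj w y) : G.Adj x y := by
  rw [mem_outer] at hx hy
  rcases h.exists_adj hx.1.symm hy.1.symm hxy hw.symm hwx hwy with h | h | h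
  · exact absurd h hx.2
  · exact absurd h hy.2
  · exact h

theorem outerDegree_lt (h : ClawFree G) {u : V} (hR : ¬ CliqueOn G (outer G u)) {w : V}
    (hw : G.Adj u w) : outerDegree G u w < (outer G u).card := by
  unfold CliqueOn at hR
  push Not at hR
  obtain ⟨x, hx, y, hy, hxy, hn⟩ := hR
  apply Finset.card_lt_card
  rw [Finset.filter_ssubset]
  by_contra! hcon
  exact hn (h.adj_of_outer hw hx hy hxy (hcon x hx) (hcon y hy))

theorem sum_outerDegree_le {u : V} {k : ℕ} (h : ∀ w, G.Adj u w → outerDegree G u w ≤ k) :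
    ∑ w ∈ G.neighborFinset u, outerDegree G u w ≤ G.degree u * k := by
  have := Finset.sum_le_card_nsmul (G.neighborFinset u) (outerDegree G u) k
    fun w hw => h w ((mem_neighborFinset _ _ _).1 hw)
  simpa using this

/-- An edge cut of a subset of the neighbourhood of `u` that contains no edges contributes all
its pairs to the missing edges. -/
theorem two_mul_card_le_sum_missing {u : V} {C D : Finset V} (hC : C ⊆ G.neighborFinset u)
    (hD : D ⊆ G.neighborFinset u) (hCD : Disjoint C D)
    (hno : ∀ w ∈ C, ∀ v ∈ D, ¬ G.Adj w v) :
    2 * (C.card * D.card) ≤ ∑ w ∈ G.neighborFinset u, missing G u w := by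
  have h1 : ∀ w ∈ C, D.card ≤ missing G u w := by
    intro w hw
    refine Finset.card_le_card fun v hv => ?_
    rw [Finset.mem_filter]
    exact ⟨hD hv, fun h => Finset.disjoint_left.1 hCD hw (h ▸ hv), hno w hw v hv⟩
  have h2 : ∀ w ∈ D, C.card ≤ missing G u w := by
    intro w hw
    refine Finset.card_le_card fun v hv => ?_
    rw [Finset.mem_filter]
    exact ⟨hC hv, fun h => Finset.disjoint_left.1 hCD hv (h ▸ hw),
      fun h => hno v hv w hw h.symm⟩
  have h3 := Finset.card_nsmul_le_sum C _ _ h1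
  have h4 := Finset.card_nsmul_le_sum D _ _ h2
  have h5 := Finset.sum_le_sum_of_subset (f := missing G u) (Finset.union_subset hC hD)
  rw [Finset.sum_union hCD] at h5
  simp only [smul_eq_mul] at h3 h4
  nlinarith

theorem CutConnected.of_sum_missing_lt {u : V} {S : Finset V} (hS : S ⊆ G.neighborFinset u)
    (h : ∑ w ∈ G.neighborFinset u, missing G u w < 2 * (S.card - 1)) : CutConnected G S := by
  intro C hCS hC hne
  by_contra! hcon
  have h1 := two_mul_card_le_sum_missing (hCS.trans hS) (Finset.sdiff_subset.trans hS)
    (Finset.disjoint_sdiff (s := C) (t := S)) fun w hw v hv => by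
      rw [Finset.mem_sdiff] at hv
      exact hcon w hw v hv.1 hv.2
  have h2 : 0 < C.card := hC.card_pos
  have h3 : 0 < (S \ C).card := by
    rw [Finset.card_pos, Finset.sdiff_nonempty]
    exact fun h => hne (hCS.antisymm h)
  have h4 := Finset.card_sdiff_add_card_eq_card hCS
  obtain ⟨i, hi⟩ := Nat.exists_eq_add_of_lt h2
  obtain ⟨j, hj⟩ := Nat.exists_eq_add_of_lt h3
  rw [hi, hj] at h1 h4
  have h5 : S.card - 1 = i + j + 1 := by omega
  rw [h5] at h
  nlinarith

/-- If three pendant vertices are attached to distinct vertices of a clique containing all other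
vertices, then the graph is isomorphic to `ENgraph n`. -/
theorem nonempty_iso_ENgraph {V : Type*} [Fintype V] {G : SimpleGraph V} {n : ℕ} (hn : 6 ≤ n)
    (hcard : Fintype.card V = n) {a p : Fin 3 → V} (ha : Function.Injective a)
    (hp : Function.Injective p) (hap : ∀ i j, a i ≠ p j)
    (hK : ∀ v w, (∀ i, v ≠ p i) → (∀ i, w ≠ p i) → v ≠ w → G.Adj v w)
    (hpa : ∀ i v, G.Adj (p i) v ↔ v = a i) : Nonempty (G ≃g ENgraph n) := by
  classical
  set f : Fin n → V := fun i => if h : i.val < 3 then a ⟨i.val, h⟩ else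
    p ⟨(i.val - (n - 3)), by omega⟩ with hf
  set s : Finset (Fin n) := Finset.univ.filter fun i => i.val < 3 ∨ n - 3 ≤ i.val with hs
  have hinj : Set.InjOn f s := by
    intro i hi j hj hij
    simp only [hs, Finset.coe_filter, Finset.mem_univ, true_and, Set.mem_ofPred_eq] at hi hj
    simp only [hf] at hij
    ext
    split_ifs at hij with h1 h2 h2
    · simpa using ha hij
    · exact absurd hij (hap _ _)
    · exact absurd hij.symm (hap _ _)
    · have := hp hij
      simp only [Fin.mk.injEq] at this
      omega
  obtain ⟨g', hg'⟩ := Finset.exists_equiv_extend_of_card_eq (t := (Finset.univ : Finset V))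
    (by simp [hcard]) (Finset.subset_univ (s.image f)) hinj
  set g : Fin n ≃ V := g'.trans (Equiv.subtypeUnivEquiv (by simp)) with hg
  have hgf : ∀ i ∈ s, g i = f i := fun i hi => hg' i hi
  have hga : ∀ k : Fin 3, g ⟨k.val, by omega⟩ = a k := by
    intro k
    rw [hgf _ (by simp [hs])]
    simp [hf]
  have hgp : ∀ (i : Fin n) (h : n - 3 ≤ i.val), g i = p ⟨i.val - (n - 3), by omega⟩ := by
    intro i h
    rw [hgf _ (by rw [hs, Finset.mem_filter]; exact ⟨Finset.mem_univ _, Or.inr h⟩)]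
    simp only [hf]
    rw [dif_neg (by omega)]
  have hgK : ∀ i : Fin n, i.val < n - 3 → ∀ k, g i ≠ p k := by
    intro i hi k hk
    have h1 := hgp ⟨k.val + (n - 3), by omega⟩ (by simp)
    simp only [Nat.add_sub_cancel] at h1
    have := g.injective (hk.trans h1.symm)
    rw [this] at hi
    simp at hi
  have hout : ∀ i j : Fin n, n - 3 ≤ i.val →
      (G.Adj (g i) (g j) ↔ (ENgraph n).Adj i j) := by
    intro i j hi
    rw [hgp i hi, hpa, ← hga, g.apply_eq_iff_eq]
    simp only [ENgraph, fromRel_adj, ne_eq, Fin.ext_iff]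
    omega
  refine ⟨(RelIso.symm ⟨g, ?_⟩ : G ≃g ENgraph n)⟩
  intro i j
  by_cases hi : n - 3 ≤ i.val
  · exact hout i j hi
  by_cases hj : n - 3 ≤ j.val
  · rw [G.adj_comm, (ENgraph n).adj_comm]
    exact hout j i hj
  push Not at hi hj
  constructor
  · intro h
    exact ⟨fun hij => h.ne (congrArg g hij), Or.inl (Or.inl ⟨hi, hj⟩)⟩
  · intro h
    exact hK _ _ (hgK i hi) (hgK j hj) fun hij => h.ne (g.injective hij)

end Structure

section Assembly

variable {V : Type*} [Fintype V] [DecidableEq V] {G : SimpleGraph V} [DecidableRel G.Adj] {u : V}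

theorem SimpleGraph.Connected.exists_adj_outer (hconn : G.Connected)
    (hR : (outer G u).Nonempty) : ∃ p ∈ outer G u, ∃ w, G.Adj u w ∧ G.Adj p w := by
  obtain ⟨p, hp, w, hw, hpw⟩ := hconn.exists_adj_crossing hR
    (fun h : u ∈ outer G u => (mem_outer.1 h).1 rfl)
  refine ⟨p, hp, w, ?_, hpw⟩
  by_contra hcon
  rw [mem_outer] at hp hw
  exact hw ⟨fun h => hp.2 (h ▸ hpw.symm), hcon⟩

theorem SimpleGraph.Connected.exists_adj_of_split (hconn : G.Connected) {S T : Finset V}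
    (hS : S.Nonempty) (hST : S ∪ T = outer G u) (hno : ∀ s ∈ S, ∀ t ∈ T, ¬ G.Adj s t) :
    ∃ p ∈ S, ∃ w, G.Adj u w ∧ G.Adj p w := by
  have hSo : S ⊆ outer G u := hST ▸ Finset.subset_union_left
  obtain ⟨p, hp, w, hw, hpw⟩ := hconn.exists_adj_crossing hS
    (fun h : u ∈ S => (mem_outer.1 (hSo h)).1 rfl)
  have hpo := mem_outer.1 (hSo hp)
  refine ⟨p, hp, w, ?_, hpw⟩
  by_contra hcon
  have hwo : w ∈ outer G u := mem_outer.2 ⟨fun h => hpo.2 (h ▸ hpw.symm), hcon⟩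
  rw [← hST, Finset.mem_union] at hwo
  exact hno p hp w (hwo.resolve_left hw) hpw

theorem exists_adj_ne {V : Type*} [Fintype V] {G : SimpleGraph V} [DecidableRel G.Adj] {u : V}
    (hd : 2 ≤ G.degree u) (w : V) : ∃ w', G.Adj u w' ∧ w' ≠ w := by
  have : 1 < (G.neighborFinset u).card := by
    rw [card_neighborFinset_eq_degree]; omega
  obtain ⟨w', hw', hne⟩ := Finset.exists_mem_ne this w
  exact ⟨w', (mem_neighborFinset _ _ _).1 hw', hne⟩

theorem ClawFree.pathOn_neighborhood (h : ClawFree G) (hc : CutConnected G (G.neighborFinset u))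
    {a b : V} (ha : G.Adj u a) (hb : G.Adj u b) (hab : a ≠ b) :
    PathOn G (insert u (G.neighborFinset u)) a b :=
  hc.pathOn_insert (h.noIndepTriple u) ((mem_neighborFinset _ _ _).2 ha)
    ((mem_neighborFinset _ _ _).2 hb) hab fun _ hs => (mem_neighborFinset _ _ _).1 hs

theorem traceable_of_pathOn_outer (h : ClawFree G) (hd : 2 ≤ G.degree u)
    (hc : CutConnected G (G.neighborFinset u)) {p q w : V} (hpq : PathOn G (outer G u) p q)
    (hw : G.Adj u w) (hqw : G.Adj q w) : Traceable G := by
  obtain ⟨w', hw', hne⟩ := exists_adj_ne hd w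
  refine (hpq.append (h.pathOn_neighborhood hc hw hw' hne.symm) hqw
    (disjoint_outer u)).traceable fun v => ?_
  have := mem_outer_or (G := G) u v
  rwa [Finset.mem_union, Finset.mem_insert]

theorem traceable_of_outer_insert (hconn : G.Connected) (h : ClawFree G)
    (hc : CutConnected G (G.neighborFinset u)) {z : V} {T : Finset V}
    (hzT : z ∉ T) (hT : CliqueOn G T) (hne : T.Nonempty) (hR : insert z T = outer G u)
    (hno : ∀ t ∈ T, ¬ G.Adj z t) : Traceable G := by
  obtain ⟨p, hp, w, hw, hpw⟩ := hconn.exists_adj_of_split (S := T) (T := {z}) hne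
    (by rw [← hR, Finset.insert_eq, Finset.union_comm])
    (by simp only [Finset.mem_singleton, forall_eq]; exact fun s hs hsz => hno s hs hsz.symm)
  obtain ⟨z', hz', b, hb, hzb⟩ := hconn.exists_adj_of_split (S := {z}) (T := T) (by simp)
    (by rw [← hR, Finset.insert_eq]) (by simpa using hno)
  rw [Finset.mem_singleton] at hz'
  subst hz'
  have hwb : w ≠ b := by
    rintro rfl
    exact hno p hp (h.adj_of_outer hw (x := z') (y := p) (by simp [← hR]) (by simp [← hR, hp])
      (fun h => hzT (h ▸ hp)) hzb.symm hpw.symm)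
  obtain ⟨q, -, hpq⟩ := hT.exists_pathOn hp
  have hdis := disjoint_outer (G := G) u
  rw [← hR, Finset.disjoint_insert_left] at hdis
  refine ((hpq.symm.append (h.pathOn_neighborhood hc hw hb hwb) hpw hdis.2).concat hzb.symm
    ?_).traceable fun v => ?_
  · rw [Finset.mem_union]
    exact fun h => h.elim hzT hdis.1
  · have := mem_outer_or (G := G) u v
    rw [← hR] at this
    simp only [Finset.mem_insert, Finset.mem_union] at this ⊢
    tauto

theorem traceable_of_two_cliques {V : Type*} [Fintype V] [DecidableEq V] {G : SimpleGraph V}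
    {u : V} {R A B : Finset V} (hR : CliqueOn G R) (hA : CliqueOn G A)
    (hB : CliqueOn G B) (hAu : ∀ a ∈ A, G.Adj u a) (hBu : ∀ b ∈ B, G.Adj u b)
    (hRA : Disjoint R A) (hRB : Disjoint R B) (hAB : Disjoint A B) (huR : u ∉ R)
    (hBne : B.Nonempty) (hcov : ∀ v, v ∈ R ∨ v = u ∨ v ∈ A ∨ v ∈ B) {p w : V} (hp : p ∈ R)
    (hw : w ∈ A) (hpw : G.Adj p w) : Traceable G := by
  obtain ⟨q, -, hpq⟩ := hR.exists_pathOn hp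
  obtain ⟨f, hf, hwf⟩ := hA.exists_pathOn hw
  obtain ⟨b, hb⟩ := hBne
  obtain ⟨e, -, hbe⟩ := hB.exists_pathOn hb
  have huA : u ∉ A := fun h => (hAu u h).ne rfl
  have huB : u ∉ B := fun h => (hBu u h).ne rfl
  have h1 := hpq.symm.append hwf hpw hRA
  have h2 := h1.concat (hAu f hf).symm (by simp [huR, huA])
  have h3 := h2.append hbe (hBu b hb) (by
    rw [Finset.disjoint_insert_left, Finset.disjoint_union_left]
    exact ⟨huB, hRB, hAB⟩)
  refine h3.traceable fun v => ?_
  have := hcov v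
  simp only [Finset.mem_insert, Finset.mem_union]
  tauto

theorem nonempty_iso_of_pendants {V : Type*} [Fintype V] {G : SimpleGraph V} {n : ℕ}
    (hn : 6 ≤ n) (hcard : Fintype.card V = n) {K : Finset V} (hK : CliqueOn G K)
    {a₁ a₂ a₃ p₁ p₂ p₃ : V} (ha₁ : a₁ ∈ K) (ha₂ : a₂ ∈ K)
    (ha₃ : a₃ ∈ K) (h₁₂ : a₁ ≠ a₂) (h₁₃ : a₁ ≠ a₃) (h₂₃ : a₂ ≠ a₃) (hp₁ : p₁ ∉ K)
    (hp₂ : p₂ ∉ K) (hp₃ : p₃ ∉ K) (hcov : ∀ v, v ∈ K ∨ v = p₁ ∨ v = p₂ ∨ v = p₃)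
    (h₁ : ∀ v, G.Adj p₁ v ↔ v = a₁) (h₂ : ∀ v, G.Adj p₂ v ↔ v = a₂)
    (h₃ : ∀ v, G.Adj p₃ v ↔ v = a₃) : Nonempty (G ≃g ENgraph n) := by
  have e₁ := (h₁ a₁).2 rfl
  have e₂ := (h₂ a₂).2 rfl
  have e₃ := (h₃ a₃).2 rfl
  have g₁₂ : p₁ ≠ p₂ := by rintro rfl; exact h₁₂ ((h₂ _).1 e₁)
  have g₁₃ : p₁ ≠ p₃ := by rintro rfl; exact h₁₃ ((h₃ _).1 e₁)
  have g₂₃ : p₂ ≠ p₃ := by rintro rfl; exact h₂₃ ((h₃ _).1 e₂)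
  refine nonempty_iso_ENgraph hn hcard (a := ![a₁, a₂, a₃]) (p := ![p₁, p₂, p₃]) ?_ ?_ ?_ ?_ ?_
  · intro i j
    fin_cases i <;> fin_cases j <;> simp_all [eq_comm]
  · intro i j
    fin_cases i <;> fin_cases j <;> simp_all [eq_comm]
  · have hne : ∀ a ∈ K, ∀ p ∉ K, a ≠ p := fun a ha p hp h => hp (h ▸ ha)
    intro i j
    fin_cases i <;> fin_cases j <;> simp <;> apply hne <;> assumption
  · intro v w hv hw hvw
    simp only [Fin.forall_fin_succ, Matrix.cons_val_zero, Matrix.cons_val_succ,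
      IsEmpty.forall_iff, and_true] at hv hw
    exact hK v (by have := hcov v; tauto) w (by have := hcov w; tauto) hvw
  · intro i
    fin_cases i <;> simpa

/-- Two nonadjacent vertices outside the closed neighbourhood of `u`, which consists of a clique
and a vertex `z` adjacent only to `u` or to outer vertices. -/
theorem traceable_or_iso_of_singleton_cut {n : ℕ} (hn : 6 ≤ n) (hcard : Fintype.card V = n)
    (hconn : G.Connected) (h : ClawFree G) (hd : 4 ≤ G.degree u) {x y z : V} (hxy : x ≠ y)
    (hR : outer G u = {x, y}) (hnxy : ¬ G.Adj x y) {B : Finset V} (hzB : z ∉ B)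
    (hN : G.neighborFinset u = insert z B) (hB : CliqueOn G B) (hno : ∀ b ∈ B, ¬ G.Adj z b) :
    Traceable G ∨ Nonempty (G ≃g ENgraph n) := by
  have huz : G.Adj u z := by rw [← mem_neighborFinset, hN]; simp
  have huB : ∀ b ∈ B, G.Adj u b := fun b hb => by rw [← mem_neighborFinset, hN]; simp [hb]
  have hAdju : ∀ v, G.Adj u v → v = z ∨ v ∈ B := fun v hv => by
    rw [← mem_neighborFinset, hN] at hv; simpa using hv
  have hxo : x ∈ outer G u := by simp [hR]
  have hyo : y ∈ outer G u := by simp [hR]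
  have hx := mem_outer.1 hxo
  have hy := mem_outer.1 hyo
  have hcov : ∀ v, v = x ∨ v = y ∨ v = u ∨ v = z ∨ v ∈ B := by
    intro v
    have := mem_outer_or (G := G) u v
    rw [hR, hN] at this
    simp only [Finset.mem_insert, Finset.mem_singleton] at this
    tauto
  have hBcard : 3 ≤ B.card := by
    have := congrArg Finset.card hN
    rw [card_neighborFinset_eq_degree, Finset.card_insert_of_notMem hzB] at this
    omega
  have hdisj : ∀ w, G.Adj u w → G.Adj x w → ¬ G.Adj y w := fun w hw h1 h2 =>
    hnxy (h.adj_of_outer hw hxo hyo hxy h1.symm h2.symm)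
  obtain ⟨x', hx', a, ha, hxa⟩ := hconn.exists_adj_of_split (u := u) (S := {x}) (T := {y})
    (by simp) (by rw [hR]; rfl) (by simpa)
  obtain ⟨y', hy', b, hb, hyb⟩ := hconn.exists_adj_of_split (u := u) (S := {y}) (T := {x})
    (by simp) (by rw [hR, Finset.union_comm]; rfl) (by simpa using fun h => hnxy h.symm)
  rw [Finset.mem_singleton] at hx' hy'
  subst hx' hy'
  have huB' : u ∉ B := fun h => (huB u h).ne rfl
  have hxB : x' ∉ B := fun h => hx.2 (huB _ h)
  have hyB : y' ∉ B := fun h => hy.2 (huB _ h)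
  have hxz' : x' ≠ z := fun h => hx.2 (h ▸ huz)
  have huz' := huz.ne
  have hyz' : y' ≠ z := fun h => hy.2 (h ▸ huz)
  -- an outer vertex adjacent to `z` extends the path at `z`
  have hextend : ∀ {x y b : V}, x ≠ y → G.Adj x z → G.Adj y b → b ∈ B → x ∉ B → y ∉ B →
      x ≠ u → y ≠ u → x ≠ z → y ≠ z → (∀ v, v = x ∨ v = y ∨ v = u ∨ v = z ∨ v ∈ B) →
      Traceable G := by
    intro x y b hxy hxz hyb hb hxB hyB hxu hyu hxz' hyz' hcov
    obtain ⟨c, hc, hbc⟩ := hB.exists_pathOn hb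
    have h1 := hbc.symm.cons (huB c hc) huB'
    have h2 := h1.cons huz.symm (by simp [huz'.symm, hzB])
    have h3 := h2.cons hxz (by simp [hxu, hxz', hxB])
    have h4 := h3.concat hyb.symm (by simp [hxy.symm, hyu, hyz', hyB])
    refine h4.traceable fun v => ?_
    have := hcov v
    simp only [Finset.mem_insert]
    tauto
  -- an outer vertex with two neighbours in `B` can be inserted
  have hinsert : ∀ {x y a a' b : V}, x ≠ y → G.Adj x a → G.Adj x a' → G.Adj y b → a ∈ B → a' ∈ B →
      b ∈ B → a ≠ a' → a ≠ b → a' ≠ b → x ∉ B → y ∉ B →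
      x ≠ u → y ≠ u → x ≠ z → y ≠ z → (∀ v, v = x ∨ v = y ∨ v = u ∨ v = z ∨ v ∈ B) →
      Traceable G := by
    intro x y a a' b hxy hxa hxa' hyb ha ha' hb haa' hab ha'b hxB hyB hxu hyu hxz' hyz' hcov
    have haB : a ∈ (B.erase a').erase b := by simp [haa', hab, ha]
    obtain ⟨c, hc, hac⟩ := (hB.mono (S := (B.erase a').erase b)
      ((Finset.erase_subset _ _).trans (Finset.erase_subset _ _))).exists_pathOn haB
    have hc' : c ∈ B := Finset.mem_of_mem_erase (Finset.mem_of_mem_erase hc)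
    have h1 := hac.symm.cons (huB c hc') (by simp [huB'])
    have h2 := h1.cons huz.symm (by simp [huz'.symm, hzB])
    have h3 := h2.concat hxa.symm (by simp [hxu, hxz', hxB])
    have h4 := h3.concat hxa' (by
      have : a' ≠ u := (huB a' ha').ne'
      have h' : a' ≠ z := fun h => hzB (h ▸ ha')
      simp [this, h', hxa'.ne'])
    have h5 := h4.concat (hB a' ha' b hb ha'b) (by
      have h1 : b ≠ u := (huB b hb).ne'
      have h2 : b ≠ z := fun h => hzB (h ▸ hb)
      have h3 : b ≠ x := fun h => hxB (h ▸ hb)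
      simp [h1, h2, h3, ha'b.symm])
    have h6 := h5.concat hyb.symm (by
      have h1 : y ≠ b := hyb.ne
      have h2 : y ≠ a' := fun h => hyB (h ▸ ha')
      simp [h1, h2, hxy.symm, hyz', hyu, hyB])
    refine h6.traceable fun v => ?_
    have := hcov v
    simp only [Finset.mem_insert, Finset.mem_erase]
    tauto
  have hcov' : ∀ v, v = y' ∨ v = x' ∨ v = u ∨ v = z ∨ v ∈ B := fun v => by
    have := hcov v; tauto
  by_cases hzx : G.Adj x' z
  · refine Or.inl (hextend hxy hzx hyb ?_ hxB hyB hx.1 hy.1 hxz' hyz' hcov)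
    exact (hAdju b hb).resolve_left fun h => hdisj z huz hzx (h ▸ hyb)
  by_cases hzy : G.Adj y' z
  · refine Or.inl (hextend hxy.symm hzy hxa ?_ hyB hxB hy.1 hx.1 hyz' hxz' hcov')
    exact (hAdju a ha).resolve_left fun h => hzx (h ▸ hxa)
  have haB : a ∈ B := (hAdju a ha).resolve_left fun h => hzx (h ▸ hxa)
  have hbB : b ∈ B := (hAdju b hb).resolve_left fun h => hzy (h ▸ hyb)
  have hab : a ≠ b := by rintro rfl; exact hdisj a ha hxa hyb
  by_cases hxs : ∃ a' ∈ B, a' ≠ a ∧ G.Adj x' a'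
  · obtain ⟨a', ha', hne, hxa'⟩ := hxs
    refine Or.inl (hinsert hxy hxa hxa' hyb haB ha' hbB hne.symm hab ?_ hxB hyB hx.1 hy.1 hxz' hyz'
      hcov)
    rintro rfl
    exact hdisj a' hb hxa' hyb
  by_cases hys : ∃ b' ∈ B, b' ≠ b ∧ G.Adj y' b'
  · obtain ⟨b', hb', hne, hyb'⟩ := hys
    refine Or.inl (hinsert hxy.symm hyb hyb' hxa hbB hb' haB hne.symm hab.symm ?_ hyB hxB hy.1 hx.1
      hyz' hxz' hcov')
    rintro rfl
    exact hdisj b' ha hxa hyb'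
  push Not at hxs hys
  refine Or.inr (nonempty_iso_of_pendants hn hcard (K := insert u B) (a₁ := u) (a₂ := a)
    (a₃ := b) (p₁ := z) (p₂ := x') (p₃ := y') ?_ (by simp) (by simp [haB]) (by simp [hbB])
    ha.ne hb.ne hab (by simp [huz'.symm, hzB]) (by simp [hx.1, hxB]) (by simp [hy.1, hyB])
    ?_ ?_ ?_ ?_)
  · intro p hp q hq hpq
    rw [Finset.mem_insert] at hp hq
    rcases hp with rfl | hp <;> rcases hq with rfl | hq
    · exact absurd rfl hpq
    · exact huB q hq
    · exact (huB p hp).symm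
    · exact hB p hp q hq hpq
  · intro v
    have := hcov v
    simp only [Finset.mem_insert]
    tauto
  · refine fun v => ⟨fun hv => ?_, by rintro rfl; exact huz.symm⟩
    rcases hcov v with rfl | rfl | rfl | rfl | hvB
    · exact absurd hv.symm hzx
    · exact absurd hv.symm hzy
    · rfl
    · exact absurd rfl hv.ne
    · exact absurd hv (hno v hvB)
  · refine fun v => ⟨fun hv => ?_, by rintro rfl; exact hxa⟩
    rcases hcov v with rfl | rfl | rfl | rfl | hvB
    · exact absurd rfl hv.ne
    · exact absurd hv hnxy
    · exact absurd hv.symm hx.2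
    · exact absurd hv hzx
    · by_contra hne; exact hxs v hvB hne hv
  · refine fun v => ⟨fun hv => ?_, by rintro rfl; exact hyb⟩
    rcases hcov v with rfl | rfl | rfl | rfl | hvB
    · exact absurd hv.symm hnxy
    · exact absurd rfl hv.ne
    · exact absurd hv.symm hy.2
    · exact absurd hv hzy
    · by_contra hne; exact hys v hvB hne hv

end Assembly

section Conclusion

variable {V : Type*} [Fintype V] [DecidableEq V] {G : SimpleGraph V} [DecidableRel G.Adj] {u : V}

theorem adj_of_missing_eq_zero {w : V} (h : missing G u w = 0) {v : V} (hv : G.Adj u v)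
    (hvw : v ≠ w) : G.Adj w v := by
  rw [missing, Finset.card_eq_zero, Finset.filter_eq_empty_iff] at h
  by_contra hcon
  exact h ((mem_neighborFinset _ _ _).2 hv) ⟨hvw, hcon⟩

/-- Three pairwise nonadjacent vertices outside the closed neighbourhood of `u`, each with exactly
one neighbour in the clique `N(u)`. -/
theorem nonempty_iso_of_outer_pendants {n : ℕ} (hn : 6 ≤ n) (hcard : Fintype.card V = n)
    {x y z a b c : V} (hR : outer G u = {x, y, z})
    (hnxy : ¬ G.Adj x y) (hnxz : ¬ G.Adj x z) (hnyz : ¬ G.Adj y z)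
    (hzero : ∀ w, G.Adj u w → missing G u w = 0)
    (ha : G.Adj u a) (hb : G.Adj u b) (hc : G.Adj u c) (hab : a ≠ b) (hac : a ≠ c) (hbc : b ≠ c)
    (hx : ∀ v, G.Adj u v → (G.Adj x v ↔ v = a)) (hy : ∀ v, G.Adj u v → (G.Adj y v ↔ v = b))
    (hz : ∀ v, G.Adj u v → (G.Adj z v ↔ v = c)) : Nonempty (G ≃g ENgraph n) := by
  have hxo : x ∈ outer G u := by simp [hR]
  have hyo : y ∈ outer G u := by simp [hR]
  have hzo : z ∈ outer G u := by simp [hR]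
  have hmemN : ∀ v, v ∈ G.neighborFinset u ↔ G.Adj u v := fun v => mem_neighborFinset _ _ _
  have hK : CliqueOn G (insert u (G.neighborFinset u)) := by
    intro p hp q hq hpq
    rw [Finset.mem_insert, hmemN] at hp hq
    rcases hp with hp | hp
    · rw [hp] at hpq ⊢
      exact hq.resolve_left hpq.symm
    · rcases hq with hq | hq
      · rw [hq]
        exact hp.symm
      · exact adj_of_missing_eq_zero (hzero p hp) hq hpq.symm
  have hnot : ∀ p, p ∈ outer G u → p ∉ insert u (G.neighborFinset u) := by
    intro p hp
    rw [Finset.mem_insert, hmemN, not_or]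
    exact mem_outer.1 hp
  have hcov : ∀ v, v ∈ insert u (G.neighborFinset u) ∨ v = x ∨ v = y ∨ v = z := by
    intro v
    have := mem_outer_or (G := G) u v
    rw [hR] at this
    simp only [Finset.mem_insert, Finset.mem_singleton] at this ⊢
    tauto
  have hpend : ∀ p e, p ∈ outer G u → ¬ G.Adj p x → ¬ G.Adj p y → ¬ G.Adj p z → G.Adj u e →
      (∀ v, G.Adj u v → (G.Adj p v ↔ v = e)) → ∀ v, G.Adj p v ↔ v = e := by
    intro p e hp hpx hpy hpz he h v
    refine ⟨fun hv => ?_, fun hv => (h v (hv ▸ he)).2 hv⟩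
    rcases hcov v with hvN | hv' | hv' | hv'
    · rw [Finset.mem_insert, hmemN] at hvN
      rcases hvN with hvN | hvN
      · exact absurd (hvN ▸ hv).symm (mem_outer.1 hp).2
      · exact (h v hvN).1 hv
    · exact absurd (hv' ▸ hv) hpx
    · exact absurd (hv' ▸ hv) hpy
    · exact absurd (hv' ▸ hv) hpz
  exact nonempty_iso_of_pendants hn hcard hK
    (Finset.mem_insert_of_mem ((hmemN a).2 ha)) (Finset.mem_insert_of_mem ((hmemN b).2 hb))
    (Finset.mem_insert_of_mem ((hmemN c).2 hc)) hab hac hbc (hnot x hxo) (hnot y hyo) (hnot z hzo)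
    hcov (hpend x a hxo G.irrefl hnxy hnxz ha hx)
    (hpend y b hyo (fun h => hnxy h.symm) G.irrefl hnyz hb hy)
    (hpend z c hzo (fun h => hnxz h.symm) (fun h => hnyz h.symm) G.irrefl hc hz)

/-- Three pairwise nonadjacent vertices outside the closed neighbourhood of `u`, one of which can
be inserted into a path through the neighbourhood. -/
theorem traceable_of_insertable (h : ClawFree G) (hd : 5 ≤ G.degree u)
    (hm : ∑ w ∈ G.neighborFinset u, missing G u w + 3 ≤ G.degree u) {x y z a a' b c : V}
    (hR : outer G u = {x, y, z}) (hxy : x ≠ y) (hxz : x ≠ z) (hyz : y ≠ z)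
    (hnxy : ¬ G.Adj x y) (hnxz : ¬ G.Adj x z) (hnyz : ¬ G.Adj y z)
    (ha : G.Adj u a) (ha' : G.Adj u a') (hb : G.Adj u b) (hc : G.Adj u c) (haa' : a ≠ a')
    (hxa : G.Adj x a) (hxa' : G.Adj x a') (hyb : G.Adj y b) (hzc : G.Adj z c)
    (hab : G.Adj a b) : Traceable G := by
  have hxo : x ∈ outer G u := by simp [hR]
  have hyo : y ∈ outer G u := by simp [hR]
  have hzo : z ∈ outer G u := by simp [hR]
  have hx := mem_outer.1 hxo
  have hy := mem_outer.1 hyo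
  have hz := mem_outer.1 hzo
  have ha'b : a' ≠ b := by
    rintro rfl; exact hnxy (h.adj_of_outer ha' hxo hyo hxy hxa'.symm hyb.symm)
  have hac : a ≠ c := by
    rintro rfl; exact hnxz (h.adj_of_outer ha hxo hzo hxz hxa.symm hzc.symm)
  have ha'c : a' ≠ c := by
    rintro rfl; exact hnxz (h.adj_of_outer ha' hxo hzo hxz hxa'.symm hzc.symm)
  have hbc : b ≠ c := by
    rintro rfl; exact hnyz (h.adj_of_outer hb hyo hzo hyz hyb.symm hzc.symm)
  set F := ((G.neighborFinset u).erase a).erase b with hF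
  have hmemF : ∀ v, v ∈ F ↔ v ≠ b ∧ v ≠ a ∧ G.Adj u v := fun v => by simp [hF]
  have hFN : F ⊆ G.neighborFinset u := fun v hv => by
    rw [mem_neighborFinset]; exact ((hmemF v).1 hv).2.2
  have hFcard : F.card = G.degree u - 1 - 1 := by
    rw [hF, Finset.card_erase_of_mem, Finset.card_erase_of_mem, card_neighborFinset_eq_degree]
    · simpa
    · simpa using ⟨hab.ne', hb⟩
  have hFc : CutConnected G F := CutConnected.of_sum_missing_lt hFN (by omega)
  have hnF : ∀ v, ¬ G.Adj u v → v ∉ F := fun v hv hvF => hv ((hmemF v).1 hvF).2.2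
  have h1 := hFc.pathOn_insert (u := u) (a := a') (b := c) ((h.noIndepTriple u).mono hFN)
    ((hmemF _).2 ⟨ha'b, haa'.symm, ha'⟩) ((hmemF _).2 ⟨hbc.symm, hac.symm, hc⟩) ha'c
    fun s hs => ((hmemF s).1 hs).2.2
  have h2 := h1.cons hxa' (by simp [hx.1, hnF x hx.2])
  have h3 := h2.cons hxa.symm (by
    have : a ∉ F := fun h => ((hmemF a).1 h).2.1 rfl
    simp [hxa.ne', ha.ne', this])
  have h4 := h3.cons hab.symm (by
    have h5 : b ∉ F := fun h => ((hmemF b).1 h).1 rfl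
    have h6 : b ≠ x := fun h => hx.2 (h ▸ hb)
    simp [hab.ne', h6, hb.ne', h5])
  have h5 := h4.cons hyb (by
    have h6 : y ≠ a := fun h => hy.2 (h ▸ ha)
    simp [hyb.ne, h6, hxy.symm, hy.1, hnF y hy.2])
  have h6 := h5.concat hzc.symm (by
    have h7 : z ≠ a := fun h => hz.2 (h ▸ ha)
    have h8 : z ≠ b := fun h => hz.2 (h ▸ hb)
    simp [h7, h8, hyz.symm, hxz.symm, hz.1, hnF z hz.2])
  refine h6.traceable fun v => ?_
  have := mem_outer_or (G := G) u v
  rw [hR, mem_neighborFinset] at this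
  simp only [Finset.mem_insert, Finset.mem_singleton, hmemF] at this ⊢
  tauto

theorem traceable_of_two_le_card (h : ClawFree G) (hd : 5 ≤ G.degree u)
    (hm : ∑ w ∈ G.neighborFinset u, missing G u w + 3 ≤ G.degree u) {x y z t : V}
    (hR : outer G u = {x, y, z}) (hxy : x ≠ y) (hxz : x ≠ z) (hyz : y ≠ z)
    (hnxy : ¬ G.Adj x y) (hnxz : ¬ G.Adj x z) (hnyz : ¬ G.Adj y z)
    (hx2 : 2 ≤ ((G.neighborFinset u).filter (G.Adj x)).card)
    (hy : ∃ b, G.Adj u b ∧ G.Adj y b) (hz : ∃ c, G.Adj u c ∧ G.Adj z c)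
    (ht : G.Adj u t) (htu : ∀ v, G.Adj u v → v ≠ t → G.Adj t v)
    (ht' : G.Adj x t ∨ G.Adj y t ∨ G.Adj z t) : Traceable G := by
  have hxo : x ∈ outer G u := by simp [hR]
  have hyo : y ∈ outer G u := by simp [hR]
  obtain ⟨b, hb, hyb⟩ := hy
  obtain ⟨c, hc, hzc⟩ := hz
  have hother : ∀ a, ∃ a', G.Adj u a' ∧ G.Adj x a' ∧ a' ≠ a := fun a => by
    obtain ⟨a', ha', hne⟩ := Finset.exists_mem_ne hx2 a
    rw [Finset.mem_filter, mem_neighborFinset] at ha'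
    exact ⟨a', ha'.1, ha'.2, hne⟩
  rcases ht' with hxt | hyt | hzt
  · obtain ⟨a', ha', hxa', hne⟩ := hother t
    refine traceable_of_insertable h hd hm hR hxy hxz hyz hnxy hnxz hnyz ht ha' hb hc hne.symm
      hxt hxa' hyb hzc (htu b hb ?_)
    rintro rfl
    exact hnxy (h.adj_of_outer ht hxo hyo hxy hxt.symm hyb.symm)
  · obtain ⟨a, ha, hxa, hat⟩ := hother t
    obtain ⟨a', ha', hxa', hne⟩ := hother a
    exact traceable_of_insertable h hd hm hR hxy hxz hyz hnxy hnxz hnyz ha ha' ht hc hne.symm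
      hxa hxa' hyt hzc (htu a ha hat).symm
  · obtain ⟨a, ha, hxa, hat⟩ := hother t
    obtain ⟨a', ha', hxa', hne⟩ := hother a
    exact traceable_of_insertable h hd hm (by rw [hR, Finset.pair_comm]) hxz hxy hyz.symm hnxz
      hnxy (fun h => hnyz h.symm) ha ha' ht hb hne.symm hxa hxa' hzt hyb (htu a ha hat).symm

/-- Three pairwise nonadjacent vertices outside the closed neighbourhood of `u`. -/
theorem traceable_or_iso_of_three_outer {n : ℕ} (hn : 6 ≤ n) (hcard : Fintype.card V = n)
    (hconn : G.Connected) (h : ClawFree G) (hd : 5 ≤ G.degree u) {x y z : V}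
    (hR : outer G u = {x, y, z}) (hxy : x ≠ y) (hxz : x ≠ z) (hyz : y ≠ z)
    (hnxy : ¬ G.Adj x y) (hnxz : ¬ G.Adj x z) (hnyz : ¬ G.Adj y z)
    (hm : ∑ w ∈ G.neighborFinset u, missing G u w + 3 ≤
      ∑ w ∈ G.neighborFinset u, outerDegree G u w) :
    Traceable G ∨ Nonempty (G ≃g ENgraph n) := by
  have hxo : x ∈ outer G u := by simp [hR]
  have hyo : y ∈ outer G u := by simp [hR]
  have hzo : z ∈ outer G u := by simp [hR]
  set N := G.neighborFinset u with hN
  have hmemN : ∀ v, v ∈ N ↔ G.Adj u v := fun v => mem_neighborFinset _ _ _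
  set X := N.filter (G.Adj x) with hX
  set Y := N.filter (G.Adj y) with hY
  set Z := N.filter (G.Adj z) with hZ
  have hsum : ∑ w ∈ N, outerDegree G u w = X.card + Y.card + Z.card := by
    have h1 := Finset.sum_card_bipartiteAbove_eq_sum_card_bipartiteBelow (s := N)
      (t := outer G u) G.Adj
    have h2 : ∑ v ∈ outer G u, (N.bipartiteBelow G.Adj v).card = X.card + Y.card + Z.card := by
      rw [hR, Finset.sum_insert (by simp [hxy, hxz]), Finset.sum_insert (by simp [hyz]),
        Finset.sum_singleton]
      simp only [Finset.bipartiteBelow, hX, hY, hZ, G.adj_comm, add_assoc]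
    exact h1.trans h2
  have hdis : ∀ {p q : V}, p ∈ outer G u → q ∈ outer G u → p ≠ q → ¬ G.Adj p q →
      Disjoint (N.filter (G.Adj p)) (N.filter (G.Adj q)) := by
    intro p q hp hq hpq hn
    rw [Finset.disjoint_left]
    intro w hw hw'
    rw [Finset.mem_filter, hmemN] at hw hw'
    exact hn (h.adj_of_outer hw.1 hp hq hpq hw.2.symm hw'.2.symm)
  have hXY : Disjoint X Y := hdis hxo hyo hxy hnxy
  have hXZ : Disjoint X Z := hdis hxo hzo hxz hnxz
  have hYZ : Disjoint Y Z := hdis hyo hzo hyz hnyz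
  have hXYZ : Disjoint (X ∪ Y) Z := Finset.disjoint_union_left.2 ⟨hXZ, hYZ⟩
  have hU : X ∪ Y ∪ Z ⊆ N := Finset.union_subset (Finset.union_subset (Finset.filter_subset _ _)
    (Finset.filter_subset _ _)) (Finset.filter_subset _ _)
  have hUcard : (X ∪ Y ∪ Z).card = X.card + Y.card + Z.card := by
    rw [Finset.card_union_of_disjoint hXYZ, Finset.card_union_of_disjoint hXY]
  rw [hsum] at hm
  have hm' : ∑ w ∈ N, missing G u w + 3 ≤ G.degree u := by
    have := Finset.card_le_card hU
    rw [hN, card_neighborFinset_eq_degree] at this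
    omega
  have hnyx : ¬ G.Adj y x := fun h => hnxy h.symm
  have hnzx : ¬ G.Adj z x := fun h => hnxz h.symm
  have hnzy : ¬ G.Adj z y := fun h => hnyz h.symm
  obtain ⟨x', hx', a, ha, hxa⟩ := hconn.exists_adj_of_split (u := u) (S := {x}) (T := {y, z})
    (by simp) (by rw [hR]; rfl) (by simp [hnxy, hnxz])
  obtain ⟨y', hy', b, hb, hyb⟩ := hconn.exists_adj_of_split (u := u) (S := {y}) (T := {x, z})
    (by simp) (by rw [hR, Finset.insert_comm]; rfl)
    (by simp [hnyx, hnyz])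
  obtain ⟨z', hz', c, hc, hzc⟩ := hconn.exists_adj_of_split (u := u) (S := {z}) (T := {x, y})
    (by simp) (by rw [hR, Finset.pair_comm y z, Finset.insert_comm]; rfl)
    (by simp [hnzx, hnzy])
  rw [Finset.mem_singleton] at hx' hy' hz'
  subst hx' hy' hz'
  obtain ⟨t, ht, ht0⟩ : ∃ t ∈ X ∪ Y ∪ Z, missing G u t = 0 := by
    by_contra! hcon
    have h1 : (X ∪ Y ∪ Z).card ≤ ∑ w ∈ X ∪ Y ∪ Z, missing G u w := by
      simpa using Finset.card_nsmul_le_sum (X ∪ Y ∪ Z) (missing G u) 1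
        fun w hw => Nat.one_le_iff_ne_zero.2 (hcon w hw)
    have h2 : ∑ w ∈ X ∪ Y ∪ Z, missing G u w ≤ ∑ w ∈ N, missing G u w :=
      Finset.sum_le_sum_of_subset hU
    omega
  have htN := (hmemN t).1 (hU ht)
  have htadj : G.Adj x' t ∨ G.Adj y' t ∨ G.Adj z' t := by
    simp only [hX, hY, hZ, Finset.mem_union, Finset.mem_filter] at ht
    tauto
  have htu : ∀ v, G.Adj u v → v ≠ t → G.Adj t v := fun v hv => adj_of_missing_eq_zero ht0 hv
  by_cases hx2 : 2 ≤ X.card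
  · exact Or.inl (traceable_of_two_le_card h hd hm' hR hxy hxz hyz hnxy hnxz hnyz hx2
      ⟨b, hb, hyb⟩ ⟨c, hc, hzc⟩ htN htu htadj)
  by_cases hy2 : 2 ≤ Y.card
  · exact Or.inl (traceable_of_two_le_card h hd hm' (by rw [hR, Finset.insert_comm]) hxy.symm hyz
      hxz hnyx hnyz hnxz hy2 ⟨a, ha, hxa⟩ ⟨c, hc, hzc⟩ htN htu (by tauto))
  by_cases hz2 : 2 ≤ Z.card
  · exact Or.inl (traceable_of_two_le_card h hd hm'
      (by rw [hR, Finset.pair_comm y' z', Finset.insert_comm]) hxz.symm hyz.symm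
      hxy hnzx hnzy hnxy hz2 ⟨a, ha, hxa⟩ ⟨b, hb, hyb⟩ htN htu (by tauto))
  have haX : a ∈ X := by rw [hX, Finset.mem_filter]; exact ⟨(hmemN a).2 ha, hxa⟩
  have hbY : b ∈ Y := by rw [hY, Finset.mem_filter]; exact ⟨(hmemN b).2 hb, hyb⟩
  have hcZ : c ∈ Z := by rw [hZ, Finset.mem_filter]; exact ⟨(hmemN c).2 hc, hzc⟩
  have hzero : ∀ w, G.Adj u w → missing G u w = 0 := by
    have : ∑ w ∈ N, missing G u w = 0 := by omega
    intro w hw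
    exact Finset.sum_eq_zero_iff.1 this w ((hmemN w).2 hw)
  have hone : ∀ p e, e ∈ N.filter (G.Adj p) → ¬ 2 ≤ (N.filter (G.Adj p)).card →
      ∀ v, G.Adj u v → (G.Adj p v ↔ v = e) := by
    intro p e he h2 v hv
    refine ⟨fun hpv => ?_, fun hve => hve ▸ (Finset.mem_filter.1 he).2⟩
    exact Finset.card_le_one.1 (by omega) v (Finset.mem_filter.2 ⟨(hmemN v).2 hv, hpv⟩) e he
  exact Or.inr (nonempty_iso_of_outer_pendants hn hcard hR hnxy hnxz hnyz hzero ha hb hc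
    (fun h => Finset.disjoint_left.1 hXY haX (h ▸ hbY))
    (fun h => Finset.disjoint_left.1 hXZ haX (h ▸ hcZ))
    (fun h => Finset.disjoint_left.1 hYZ hbY (h ▸ hcZ))
    (hone x' a haX hx2) (hone y' b hbY hy2) (hone z' c hcZ hz2))

theorem traceable_or_iso_of_not_cutConnected {n : ℕ} (hn : 6 ≤ n) (hcard : Fintype.card V = n)
    (hconn : G.Connected) (h : ClawFree G) (hd : 6 ≤ G.degree u)
    (hm : ∑ w ∈ G.neighborFinset u, missing G u w + 2 * (outer G u).card * G.degree u + 3 ≤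
      6 * G.degree u + ∑ w ∈ G.neighborFinset u, outerDegree G u w)
    (hc : ¬ CutConnected G (G.neighborFinset u)) :
    Traceable G ∨ Nonempty (G ≃g ENgraph n) := by
  unfold CutConnected at hc
  push Not at hc
  obtain ⟨A, hAN, hA, hAne, hno⟩ := hc
  set B := G.neighborFinset u \ A with hB
  have hAB : Disjoint A B := Finset.disjoint_sdiff
  have hBN : B ⊆ G.neighborFinset u := Finset.sdiff_subset
  have hno' : ∀ w ∈ A, ∀ v ∈ B, ¬ G.Adj w v := fun w hw v hv => by
    rw [hB, Finset.mem_sdiff] at hv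
    exact hno w hw v hv.1 hv.2
  have hunion : A ∪ B = G.neighborFinset u := Finset.union_sdiff_of_subset hAN
  have hBne : B.Nonempty := Finset.sdiff_nonempty.2 fun h => hAne (hAN.antisymm h)
  have hA' : CliqueOn G A := by
    obtain ⟨b, hb⟩ := hBne
    intro p hp q hq hpq
    rcases h.noIndepTriple u p (hAN hp) q (hAN hq) b (hBN hb) hpq
      (fun h => Finset.disjoint_left.1 hAB hp (h ▸ hb))
      (fun h => Finset.disjoint_left.1 hAB hq (h ▸ hb)) with h | h | h
    · exact h
    · exact absurd h (hno' p hp b hb)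
    · exact absurd h (hno' q hq b hb)
  have hB' : CliqueOn G B := by
    obtain ⟨a, ha⟩ := hA
    intro p hp q hq hpq
    rcases h.noIndepTriple u a (hAN ha) p (hBN hp) q (hBN hq)
      (fun h => Finset.disjoint_left.1 hAB ha (h ▸ hp))
      (fun h => Finset.disjoint_left.1 hAB ha (h ▸ hq)) hpq with h | h | h
    · exact absurd h (hno' a ha p hp)
    · exact absurd h (hno' a ha q hq)
    · exact h
  have hAu : ∀ a ∈ A, G.Adj u a := fun a ha => (mem_neighborFinset _ _ _).1 (hAN ha)
  have hBu : ∀ b ∈ B, G.Adj u b := fun b hb => (mem_neighborFinset _ _ _).1 (hBN hb)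
  have huA : u ∉ A := fun h => (hAu u h).ne rfl
  have huB : u ∉ B := fun h => (hBu u h).ne rfl
  have hdo := disjoint_outer (G := G) u
  rw [Finset.disjoint_insert_right] at hdo
  by_cases hR : CliqueOn G (outer G u)
  · left
    rcases (outer G u).eq_empty_or_nonempty with hemp | hRne
    · obtain ⟨a, ha⟩ := hA
      obtain ⟨b, hb⟩ := hBne
      obtain ⟨e, he, hae⟩ := hA'.exists_pathOn ha
      obtain ⟨f, hf, hbf⟩ := hB'.exists_pathOn hb
      refine ((hae.concat (hAu e he).symm huA).append hbf (hBu b hb)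
        (Finset.disjoint_insert_left.2 ⟨huB, hAB⟩)).traceable fun v => ?_
      have := mem_outer_or (G := G) u v
      rw [hemp, ← hunion] at this
      simp only [Finset.notMem_empty, Finset.mem_union, Finset.mem_insert, false_or] at this ⊢
      tauto
    · obtain ⟨p, hp, w, hw, hpw⟩ := hconn.exists_adj_outer hRne
      have hcov : ∀ v, v ∈ outer G u ∨ v = u ∨ v ∈ A ∨ v ∈ B := by
        intro v
        have := mem_outer_or (G := G) u v
        rwa [← hunion, Finset.mem_union] at this
      rw [← mem_neighborFinset, ← hunion, Finset.mem_union] at hw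
      rcases hw with hw | hw
      · exact traceable_of_two_cliques hR hA' hB' hAu hBu (hdo.2.mono_right hAN)
          (hdo.2.mono_right hBN) hAB hdo.1 hBne hcov hp hw hpw
      · exact traceable_of_two_cliques hR hB' hA' hBu hAu (hdo.2.mono_right hBN)
          (hdo.2.mono_right hAN) hAB.symm hdo.1 hA (fun v => by have := hcov v; tauto) hp hw hpw
  · have hcost := two_mul_card_le_sum_missing hAN hBN hAB hno'
    have hcards : A.card + B.card = G.degree u := by
      rw [← Finset.card_union_of_disjoint hAB, hunion, card_neighborFinset_eq_degree]
    have hlt : ∀ w, G.Adj u w → outerDegree G u w ≤ (outer G u).card - 1 := fun w hw => by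
      have := outerDegree_lt h hR hw
      omega
    have hsum := sum_outerDegree_le hlt
    have hA1 := hA.card_pos
    have hB1 := hBne.card_pos
    have hRc : (outer G u).card = 2 := by
      unfold CliqueOn at hR
      push Not at hR
      obtain ⟨x, hx, y, hy, hxy, -⟩ := hR
      have h2 : 2 ≤ (outer G u).card := by
        have := Finset.one_lt_card.2 ⟨x, hx, y, hy, hxy⟩
        omega
      by_contra hne
      obtain ⟨i, hi⟩ : ∃ i, (outer G u).card = i + 3 := ⟨(outer G u).card - 3, by omega⟩
      obtain ⟨j, hj⟩ : ∃ j, A.card = j + 1 := ⟨A.card - 1, by omega⟩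
      obtain ⟨k, hk⟩ : ∃ k, B.card = k + 1 := ⟨B.card - 1, by omega⟩
      rw [hi] at hsum hm
      rw [hj, hk] at hcost hcards
      have : i + 3 - 1 = i + 2 := by omega
      rw [this] at hsum
      nlinarith [Nat.zero_le (i * G.degree u), Nat.zero_le (j * k)]
    have hone : A.card = 1 ∨ B.card = 1 := by
      by_contra! hcon
      obtain ⟨j, hj⟩ : ∃ j, A.card = j + 2 := ⟨A.card - 2, by omega⟩
      obtain ⟨k, hk⟩ : ∃ k, B.card = k + 2 := ⟨B.card - 2, by omega⟩
      rw [hRc] at hsum hm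
      rw [hj, hk] at hcost hcards
      nlinarith [Nat.zero_le (j * k)]
    obtain ⟨x, y, hxy, hRxy⟩ := Finset.card_eq_two.1 hRc
    have hnxy : ¬ G.Adj x y := by
      intro hadj
      apply hR
      rw [hRxy]
      intro p hp q hq hpq
      simp only [Finset.mem_insert, Finset.mem_singleton] at hp hq
      rcases hp with rfl | rfl <;> rcases hq with rfl | rfl
      · exact absurd rfl hpq
      · exact hadj
      · exact hadj.symm
      · exact absurd rfl hpq
    rcases hone with h1 | h1
    · obtain ⟨z, rfl⟩ := Finset.card_eq_one.1 h1
      refine traceable_or_iso_of_singleton_cut hn hcard hconn h (by omega) hxy hRxy hnxy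
        (Finset.disjoint_singleton_left.1 hAB) hunion.symm hB' fun b hb => ?_
      exact hno' z (Finset.mem_singleton_self z) b hb
    · obtain ⟨z, hz⟩ := Finset.card_eq_one.1 h1
      rw [hz] at hunion hAB hno'
      refine traceable_or_iso_of_singleton_cut hn hcard hconn h (by omega) hxy hRxy hnxy
        (Finset.disjoint_singleton_right.1 hAB) (by rw [← hunion, Finset.union_comm]; rfl) hA'
        fun a ha hza => ?_
      exact hno' a ha z (Finset.mem_singleton_self z) hza.symm

theorem traceable_or_iso_of_card_outer_eq_three {n : ℕ} (hn : 6 ≤ n)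
    (hcard : Fintype.card V = n) (hconn : G.Connected) (h : ClawFree G) (hd : 6 ≤ G.degree u)
    (hm : ∑ w ∈ G.neighborFinset u, missing G u w + 3 ≤
      ∑ w ∈ G.neighborFinset u, outerDegree G u w)
    (hc : CutConnected G (G.neighborFinset u)) {x y z : V} (hxz : x ≠ z) (hxy : x ≠ y)
    (hyz : y ≠ z) (hR : outer G u = {x, y, z}) (hnxz : ¬ G.Adj x z) :
    Traceable G ∨ Nonempty (G ≃g ENgraph n) := by
  have hpair : ∀ {p q : V}, G.Adj p q → CliqueOn G {p, q} := by
    intro p q hpq s hs t ht hst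
    simp only [Finset.mem_insert, Finset.mem_singleton] at hs ht
    rcases hs with rfl | rfl <;> rcases ht with rfl | rfl
    · exact absurd rfl hst
    · exact hpq
    · exact hpq.symm
    · exact absurd rfl hst
  by_cases hyx : G.Adj x y <;> by_cases hyz' : G.Adj y z
  · left
    have hpath : PathOn G (outer G u) x z := by
      rw [hR]
      exact ((PathOn.singleton z).cons hyz' (by simpa)).cons hyx (by simp [hxy, hxz])
    obtain ⟨p, hp, w, hw, hpw⟩ := hconn.exists_adj_outer (u := u) ⟨x, by simp [hR]⟩
    by_cases hxw : G.Adj x w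
    · exact traceable_of_pathOn_outer h (by omega) hc hpath.symm hw hxw
    by_cases hzw : G.Adj z w
    · exact traceable_of_pathOn_outer h (by omega) hc hpath hw hzw
    rw [hR] at hp
    simp only [Finset.mem_insert, Finset.mem_singleton] at hp
    rcases hp with rfl | rfl | rfl
    · exact absurd hpw hxw
    · have hne : ∀ q ∈ outer G u, q ≠ w := fun q hq hqw => (mem_outer.1 hq).2 (hqw ▸ hw)
      rcases h.exists_adj hxz (hne x (by simp [hR])) (hne z (by simp [hR])) hyx.symm hyz' hpw with
        h | h | h
      · exact absurd h hnxz
      · exact absurd h hxw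
      · exact absurd h hzw
    · exact absurd hpw hzw
  · left
    have hnzx : ¬ G.Adj z x := fun h => hnxz h.symm
    have hnzy : ¬ G.Adj z y := fun h => hyz' h.symm
    refine traceable_of_outer_insert hconn h hc (z := z) (T := {x, y}) (by simp [hxz.symm, hyz.symm])
      (hpair hyx) (by simp) ?_ (by simp [hnzx, hnzy])
    rw [hR, Finset.insert_comm, Finset.pair_comm z y]
  · left
    exact traceable_of_outer_insert hconn h hc (z := x) (T := {y, z}) (by simp [hxz, hxy])
      (hpair hyz') (by simp) hR.symm (by simp [hyx, hnxz])
  · exact traceable_or_iso_of_three_outer hn hcard hconn h (by omega) hR hxy hxz hyz hyx hnxz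
      hyz' hm

theorem traceable_of_card_outer_eq_four (hconn : G.Connected) (h : ClawFree G)
    (hd : 6 ≤ G.degree u) (hRc : (outer G u).card = 4) (hR : ¬ CliqueOn G (outer G u))
    (hm : 2 * G.degree u < ∑ w ∈ G.neighborFinset u, outerDegree G u w)
    (hc : CutConnected G (G.neighborFinset u)) : Traceable G := by
  obtain ⟨w, hw, hw3⟩ : ∃ w, G.Adj u w ∧ 2 < outerDegree G u w := by
    by_contra! hcon
    have := sum_outerDegree_le hcon
    omega
  have hw4 := outerDegree_lt h hR hw
  set K := (outer G u).filter fun v => G.Adj w v with hK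
  have hKc : K.card = 3 := by
    change K.card < _ at hw4
    change 2 < K.card at hw3
    omega
  have hKR : K ⊆ outer G u := Finset.filter_subset _ _
  have hKw : ∀ k ∈ K, G.Adj w k := fun k hk => (Finset.mem_filter.1 hk).2
  have hKcl : CliqueOn G K := fun p hp q hq hpq =>
    h.adj_of_outer hw (hKR hp) (hKR hq) hpq (hKw p hp) (hKw q hq)
  have hdc : (outer G u \ K).card = 1 := by
    have := Finset.card_sdiff_add_card_eq_card hKR
    omega
  obtain ⟨v, hv⟩ := Finset.card_eq_one.1 hdc
  have hvK : v ∉ K := by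
    have : v ∈ outer G u \ K := by simp [hv]
    exact (Finset.mem_sdiff.1 this).2
  have hins : insert v K = outer G u := by
    rw [Finset.insert_eq, ← hv]
    exact Finset.sdiff_union_of_subset hKR
  by_cases hvk : ∃ k ∈ K, G.Adj v k
  · obtain ⟨k, hk, hvk⟩ := hvk
    obtain ⟨q, hq, hkq⟩ := hKcl.exists_pathOn hk
    have hpath := hkq.cons hvk hvK
    rw [hins] at hpath
    exact traceable_of_pathOn_outer h (by omega) hc hpath hw (hKw q hq).symm
  · push Not at hvk
    exact traceable_of_outer_insert hconn h hc hvK hKcl (Finset.card_pos.1 (by omega)) hins hvk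

theorem traceable_or_iso_of_cutConnected {n : ℕ} (hn : 6 ≤ n) (hcard : Fintype.card V = n)
    (hconn : G.Connected) (h : ClawFree G) (hd : 6 ≤ G.degree u)
    (hm : ∑ w ∈ G.neighborFinset u, missing G u w + 2 * (outer G u).card * G.degree u + 3 ≤
      6 * G.degree u + ∑ w ∈ G.neighborFinset u, outerDegree G u w)
    (hc : CutConnected G (G.neighborFinset u)) :
    Traceable G ∨ Nonempty (G ≃g ENgraph n) := by
  by_cases hR : CliqueOn G (outer G u)
  · left
    rcases (outer G u).eq_empty_or_nonempty with hemp | hRne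
    · obtain ⟨w, hw, -⟩ := exists_adj_ne (u := u) (G := G) (by omega) u
      obtain ⟨w', hw', hne⟩ := exists_adj_ne (u := u) (G := G) (by omega) w
      refine (h.pathOn_neighborhood hc hw hw' hne.symm).traceable fun v => ?_
      have := mem_outer_or (G := G) u v
      rw [hemp] at this
      simpa using this
    · obtain ⟨p, hp, w, hw, hpw⟩ := hconn.exists_adj_outer hRne
      obtain ⟨q, -, hpq⟩ := hR.exists_pathOn hp
      exact traceable_of_pathOn_outer h (by omega) hc hpq.symm hw hpw
  have hlt : ∀ w, G.Adj u w → outerDegree G u w ≤ (outer G u).card - 1 := fun w hw => by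
    have := outerDegree_lt h hR hw
    omega
  have hsum := sum_outerDegree_le hlt
  have hR' := hR
  unfold CliqueOn at hR'
  push Not at hR'
  obtain ⟨x, hx, z, hz, hxz, hnxz⟩ := hR'
  have h2 : 2 ≤ (outer G u).card := by
    have := Finset.one_lt_card.2 ⟨x, hx, z, hz, hxz⟩
    omega
  have h4 : (outer G u).card ≤ 4 := by
    by_contra hcon
    obtain ⟨i, hi⟩ : ∃ i, (outer G u).card = i + 5 := ⟨(outer G u).card - 5, by omega⟩
    have : i + 5 - 1 = i + 4 := by omega
    rw [hi, this] at hsum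
    rw [hi] at hm
    nlinarith [Nat.zero_le (i * G.degree u),
      Nat.zero_le (∑ w ∈ G.neighborFinset u, missing G u w)]
  have hcases : (outer G u).card = 2 ∨ (outer G u).card = 3 ∨ (outer G u).card = 4 := by omega
  have hzx : z ∈ (outer G u).erase x := Finset.mem_erase.2 ⟨hxz.symm, hz⟩
  rcases hcases with hr | hr | hr
  · left
    refine traceable_of_outer_insert hconn h hc (z := x) (T := {z}) (by simpa)
      (by intro p hp q hq hpq; simp_all) (by simp) ?_ (by simpa)
    apply Finset.eq_of_subset_of_card_le
    · intro v hv
      simp only [Finset.mem_insert, Finset.mem_singleton] at hv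
      rcases hv with rfl | rfl <;> assumption
    · rw [Finset.card_pair hxz, hr]
  · obtain ⟨y, hy⟩ : ∃ y, ((outer G u).erase x).erase z = {y} := by
      rw [← Finset.card_eq_one, Finset.card_erase_of_mem hzx, Finset.card_erase_of_mem hx, hr]
    have hy' : y ∈ ((outer G u).erase x).erase z := by simp [hy]
    rw [Finset.mem_erase, Finset.mem_erase] at hy'
    refine traceable_or_iso_of_card_outer_eq_three hn hcard hconn h hd ?_ hc hxz hy'.2.1.symm
      hy'.1 ?_ hnxz
    · rw [hr] at hm
      omega
    · rw [Finset.pair_comm y z, ← hy, Finset.insert_erase hzx, Finset.insert_erase hx]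
  · left
    refine traceable_of_card_outer_eq_four hconn h hd hr hR ?_ hc
    rw [hr] at hm
    omega

end Conclusion

theorem statement_0 {V : Type*} [Fintype V] (G : SimpleGraph V) (n : ℕ)
    (hn : 18 ≤ n) (hcard : Fintype.card V = n)
    (hconn : G.Connected) (hclaw : ClawFree G)
    (hq : qIndex G ≥ qIndex (ENgraph n)) :
    Traceable G ∨ Nonempty (G ≃g ENgraph n) := by
  classical
  have : Nontrivial V := Fintype.one_lt_card_iff_nontrivial.1 (by omega)
  obtain ⟨u, hd, hu⟩ := exists_large_neighborhood G n (by omega) hcard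
    (fun v => hconn.preconnected.degree_pos_of_nontrivial v) hq
  have hsum := sum_degree_add_sum_missing (G := G) u
  have hn' := card_eq_degree_add (G := G) u
  have hm : ∑ w ∈ G.neighborFinset u, missing G u w + 2 * (outer G u).card * G.degree u + 3 ≤
      6 * G.degree u + ∑ w ∈ G.neighborFinset u, outerDegree G u w := by
    rw [hcard] at hn'
    rw [hn'] at hu
    nlinarith
  by_cases hc : CutConnected G (G.neighborFinset u)
  · exact traceable_or_iso_of_cutConnected (by omega) hcard hconn hclaw (by omega) hm hc
  · exact traceable_or_iso_of_not_cutConnected (by omega) hcard hconn hclaw (by omega) hm hc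
end

section
/- Let k be a nonnegative integer and let G be a closed claw-free non-Hamiltonian graph on n ≥ 2k vertices. If e(G) ≥ C(n−k−1, 2) + C(k+2, 2) + 1 (where C(a,2) = a(a−1)/2 denotes a binomial coefficient), then the clique number of G satisfies ω(G) ≥ n − k. -/
open SimpleGraph

/-- Every two distinct common neighbours of two adjacent vertices are adjacent. -/
def DiamondFree {V : Type*} (G : SimpleGraph V) : Prop :=
  ∀ ⦃x y z w : V⦄, G.Adj x y → G.Adj x z → G.Adj y z → G.Adj x w → G.Adj y w → z ≠ w → G.Adj z w

theorem DiamondFree.of_isClosedGraph {V : Type*} {G : SimpleGraph V} (hclosed : IsClosedGraph G)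
    (hclaw : ClawFree G) : DiamondFree G := by
  intro x y z w hxy hxz hyz hxw hyw hzw
  by_contra hn
  refine hclosed x ⟨?_, z, w, hxz, hxw, hzw, hn⟩
  rw [connected_iff_exists_forall_reachable]
  refine ⟨⟨y, hxy⟩, fun ⟨u, hu⟩ => ?_⟩
  have hz : (G.induce (G.neighborSet x)).Reachable ⟨y, hxy⟩ ⟨z, hxz⟩ := Adj.reachable hyz
  have hw : (G.induce (G.neighborSet x)).Reachable ⟨y, hxy⟩ ⟨w, hxw⟩ := Adj.reachable hyw
  by_cases huz : u = z
  · subst huz; exact hz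
  by_cases huw : u = w
  · subst huw; exact hw
  by_cases h1 : G.Adj z u
  · exact hz.trans (Adj.reachable (G := G.induce (G.neighborSet x)) (u := ⟨z, hxz⟩) (v := ⟨u, hu⟩) h1)
  by_cases h2 : G.Adj w u
  · exact hw.trans (Adj.reachable (G := G.induce (G.neighborSet x)) (u := ⟨w, hxw⟩) (v := ⟨u, hu⟩) h2)
  exact (hclaw ⟨x, z, w, u, hzw, Ne.symm huz, Ne.symm huw, hxz, hxw, hu, hn, h1, h2⟩).elim

section EdgeCount

variable {V : Type*} [DecidableEq V] (G : SimpleGraph V) [DecidableRel G.Adj]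

/-- `K` is a largest clique of `G` among those contained in `A`. -/
def IsLargestCliqueIn (A K : Finset V) : Prop :=
  K ⊆ A ∧ G.IsClique K ∧ ∀ C ⊆ A, G.IsClique (C : Set V) → C.card ≤ K.card

/-- The number of ordered pairs of adjacent vertices in `A`. -/
def adjPairs (A : Finset V) : ℕ := ∑ x ∈ A, (A.filter (G.Adj x)).card

variable {G}

theorem exists_isLargestCliqueIn (A : Finset V) : ∃ K, IsLargestCliqueIn G A K := by
  classical
  obtain ⟨K, hK, hmax⟩ := (A.powerset.filter fun C : Finset V => G.IsClique (C : Set V)).exists_max_image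
    Finset.card ⟨∅, by simp⟩
  simp only [Finset.mem_filter, Finset.mem_powerset] at hK hmax
  exact ⟨K, hK.1, hK.2, fun C hC hc => hmax C ⟨hC, hc⟩⟩

theorem adjPairs_le_card_mul (A : Finset V) : adjPairs G A ≤ A.card * (A.card - 1) := by
  refine Finset.sum_le_card_nsmul _ _ _ fun x hx => ?_
  rw [← Finset.card_erase_of_mem hx]
  refine Finset.card_le_card fun y hy => ?_
  rw [Finset.mem_filter] at hy
  exact Finset.mem_erase.2 ⟨hy.2.ne', hy.1⟩

theorem IsLargestCliqueIn.card_filter_adj_le_one {A K : Finset V} (hG : DiamondFree G)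
    (hK : IsLargestCliqueIn G A K) {y : V} (hy : y ∈ A \ K) : (K.filter (G.Adj y)).card ≤ 1 := by
  obtain ⟨hKA, hcl, hmax⟩ := hK
  rw [Finset.mem_sdiff] at hy
  by_contra! h
  obtain ⟨a, ha, b, hb, hab⟩ := Finset.one_lt_card.1 h
  simp only [Finset.mem_filter] at ha hb
  have hins : G.IsClique ((insert y K : Finset V) : Set V) := by
    rw [Finset.coe_insert, isClique_insert]
    refine ⟨hcl, fun c hc hyc => ?_⟩
    by_cases hca : c = a
    · exact hca ▸ ha.2
    by_cases hcb : c = b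
    · exact hcb ▸ hb.2
    exact hG (hcl ha.1 hb.1 hab) ha.2.symm hb.2.symm (hcl ha.1 hc (Ne.symm hca))
      (hcl hb.1 hc (Ne.symm hcb)) hyc
  have := hmax _ (Finset.insert_subset hy.1 hKA) hins
  rw [Finset.card_insert_of_notMem hy.2] at this
  omega

theorem adjPairs_eq_add {A K : Finset V} (hKA : K ⊆ A) :
    adjPairs G A =
      adjPairs G K + 2 * ∑ y ∈ A \ K, (K.filter (G.Adj y)).card + adjPairs G (A \ K) := by
  have hsplit (x : V) : (A.filter (G.Adj x)).card =
      (K.filter (G.Adj x)).card + ((A \ K).filter (G.Adj x)).card := by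
    simp only [Finset.card_filter]
    rw [add_comm, Finset.sum_sdiff hKA]
  have hcomm : ∑ x ∈ K, ((A \ K).filter (G.Adj x)).card =
      ∑ y ∈ A \ K, (K.filter (G.Adj y)).card := by
    simp only [Finset.card_filter]
    rw [Finset.sum_comm]
    simp only [G.adj_comm]
  simp only [adjPairs]
  rw [← Finset.sum_sdiff hKA]
  simp only [hsplit, Finset.sum_add_distrib]
  rw [hcomm]
  ring

theorem IsLargestCliqueIn.adjPairs_le {A K : Finset V} (hG : DiamondFree G)
    (hK : IsLargestCliqueIn G A K) :
    adjPairs G A ≤ K.card * (K.card - 1) + 2 * (A \ K).card + adjPairs G (A \ K) := by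
  have h : ∑ y ∈ A \ K, (K.filter (G.Adj y)).card ≤ (A \ K).card := by
    simpa using Finset.sum_le_card_nsmul _ _ 1 fun y hy => hK.card_filter_adj_le_one hG hy
  have := adjPairs_le_card_mul (G := G) K
  rw [adjPairs_eq_add hK.1]
  omega

theorem IsLargestCliqueIn.adjPairs_eq_zero {A K : Finset V} (hK : IsLargestCliqueIn G A K)
    (h : K.card ≤ 1) : adjPairs G A = 0 := by
  refine Finset.sum_eq_zero fun x hx => ?_
  rw [Finset.card_eq_zero, Finset.filter_eq_empty_iff]
  intro y hy hxy
  have hpair := hK.2.2 {x, y} (by simp [Finset.insert_subset_iff, hx, hy])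
    (by simpa [isClique_pair] using fun _ => hxy)
  rw [Finset.card_pair hxy.ne] at hpair
  omega

theorem cast_mul_pred (a : ℕ) : ((a * (a - 1) : ℕ) : ℤ) = a * (a - 1) := by
  cases a <;> simp

theorem two_mul_cast_choose_two (a : ℕ) : 2 * (a.choose 2 : ℤ) = a * (a - 1) := by
  rw [← cast_mul_pred, Nat.choose_two_right, ← Nat.mul_div_cancel' a.even_mul_pred_self.two_dvd]
  simp

/-- A diamond-free graph in which no clique has more than about half of the vertices satisfies
Mantel's bound. -/
theorem DiamondFree.two_mul_adjPairs_le (hG : DiamondFree G) (A : Finset V)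
    (hA : ∀ C ⊆ A, G.IsClique (C : Set V) → 2 * C.card ≤ A.card + 1) :
    2 * adjPairs G A ≤ A.card ^ 2 := by
  induction A using Finset.strongInduction with
  | H A ih =>
  obtain ⟨K, hK⟩ := exists_isLargestCliqueIn (G := G) A
  by_cases hs : K.card ≤ 1
  · simp [hK.adjPairs_eq_zero hs]
  obtain ⟨L, hL⟩ := exists_isLargestCliqueIn (G := G) (A \ K)
  have hAK := hK.adjPairs_le hG
  have hcard := Finset.card_sdiff_add_card_eq_card hK.1
  have hsn := hA K hK.1 hK.2.1
  have hrs := hK.2.2 L (hL.1.trans Finset.sdiff_subset) hL.2.1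
  by_cases hr : 2 * L.card ≤ (A \ K).card + 1
  · have hB := ih (A \ K) (Finset.sdiff_ssubset hK.1 (Finset.card_pos.1 (by omega)))
      fun C hC hc => (Nat.mul_le_mul_left 2 (hL.2.2 C hC hc)).trans hr
    rw [← hcard]
    zify at hAK hB ⊢
    rw [← Nat.cast_mul, cast_mul_pred] at hAK
    have : (0 : ℤ) ≤ ((K.card : ℤ) - 2) * (2 * (A \ K).card - K.card) :=
      mul_nonneg (by omega) (by omega)
    nlinarith
  · have hB := hL.adjPairs_le hG
    have hC := adjPairs_le_card_mul (G := G) ((A \ K) \ L)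
    have hcard' := Finset.card_sdiff_add_card_eq_card hL.1
    rw [← hcard]
    have hle : 2 * adjPairs G A ≤ 2 * (K.card * (K.card - 1) + 2 * (A \ K).card +
        (L.card * (L.card - 1) + 2 * ((A \ K) \ L).card +
          ((A \ K) \ L).card * (((A \ K) \ L).card - 1))) := by omega
    refine hle.trans ?_
    rw [← hcard] at hsn
    rw [← hcard'] at hr hsn ⊢
    generalize ((A \ K) \ L).card = q at *
    obtain ⟨d, hd⟩ := Nat.exists_eq_add_of_le hrs
    rw [hd] at hsn ⊢
    generalize L.card = r at *
    have hd0 : (0 : ℤ) ≤ d * (2 + 2 * q - d) := mul_nonneg (by omega) (by omega)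
    have hr0 : (0 : ℤ) ≤ q * (r - q - 2) := mul_nonneg (by omega) (by omega)
    have := cast_mul_pred (r + d)
    have := cast_mul_pred r
    have := cast_mul_pred q
    zify
    push_cast at *
    nlinarith

end EdgeCount

theorem statement_5 {V : Type*} [Fintype V] [DecidableEq V] (G : SimpleGraph V)
    [DecidableRel G.Adj] (k n : ℕ) (hcard : Fintype.card V = n) (hn : 2 * k ≤ n)
    (hclosed : IsClosedGraph G) (hclaw : ClawFree G) (hham : ¬ G.IsHamiltonian)
    (he : G.edgeFinset.card ≥ (n - k - 1).choose 2 + (k + 2).choose 2 + 1) :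
    G.cliqueNum ≥ n - k := by
  by_contra! hlt
  have hG := DiamondFree.of_isClosedGraph hclosed hclaw
  obtain ⟨K, hK⟩ := exists_isLargestCliqueIn (G := G) Finset.univ
  have hKlt : K.card < n - k := hK.2.1.card_le_cliqueNum.trans_lt hlt
  have hpairs : adjPairs G Finset.univ = 2 * G.edgeFinset.card := by
    rw [← G.sum_degrees_eq_twice_card_edges]
    simp only [adjPairs, ← card_neighborFinset_eq_degree, neighborFinset_eq_filter]
  obtain ⟨a, rfl⟩ : ∃ a, n = a + k + 1 := ⟨n - k - 1, by omega⟩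
  rw [show a + k + 1 - k - 1 = a by omega] at he
  have ha := two_mul_cast_choose_two a
  have hb := two_mul_cast_choose_two (k + 2)
  push_cast at hb
  zify at he
  by_cases hs : K.card ≤ k + 1
  · have hM := hG.two_mul_adjPairs_le Finset.univ fun C hC hc => by
      have := hK.2.2 C hC hc
      rw [Finset.card_univ]
      omega
    rw [hpairs, Finset.card_univ, hcard] at hM
    zify at hM
    nlinarith [sq_nonneg ((a : ℤ) - k - 2)]
  · have h1 := hK.adjPairs_le hG
    have h2 := adjPairs_le_card_mul (G := G) (Finset.univ \ K)
    have hsum := Finset.card_sdiff_add_card_eq_card hK.1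
    rw [Finset.card_univ, hcard] at hsum
    rw [hpairs] at h1
    have h3 := cast_mul_pred K.card
    have h4 := cast_mul_pred (Finset.univ \ K).card
    have hprod : (0 : ℤ) ≤ (a - K.card) * (K.card - k - 2) :=
      mul_nonneg (by omega) (by omega)
    have hm : ((Finset.univ \ K).card : ℤ) = a + k + 1 - K.card := by omega
    zify at h1 h2
    rw [← Nat.cast_mul] at h2
    push_cast at *
    rw [hm] at *
    nlinarith
end

section
/- Let G be a connected closed claw-free non-traceable graph on n vertices. If the clique number satisfies ω(G) ≥ n − 3, then G is isomorphic to EN_n. -/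
open SimpleGraph

/-- In a closed claw-free graph, two common neighbours of the ends of an edge are adjacent. -/
theorem IsClosedGraph.adj_of_common_adj {V : Type*} {G : SimpleGraph V}
    (hclosed : IsClosedGraph G) (hclaw : ClawFree G) {x y u v : V}
    (hxy : G.Adj x y) (hxu : G.Adj x u) (hxv : G.Adj x v)
    (hyu : G.Adj y u) (hyv : G.Adj y v) (huv : u ≠ v) : G.Adj u v := by
  by_contra hn
  refine hclosed x ⟨?_, u, v, hxu, hxv, huv, hn⟩
  have step : ∀ {a b : V} (ha : G.Adj x a) (hb : G.Adj x b), G.Adj a b →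
      (G.induce (G.neighborSet x)).Reachable ⟨a, ha⟩ ⟨b, hb⟩ :=
    fun _ _ hab => Adj.reachable (by simpa using hab)
  have hu : (G.induce (G.neighborSet x)).Reachable ⟨y, hxy⟩ ⟨u, hxu⟩ := step hxy hxu hyu
  have hv : (G.induce (G.neighborSet x)).Reachable ⟨y, hxy⟩ ⟨v, hxv⟩ := step hxy hxv hyv
  refine (connected_iff_exists_forall_reachable _).2 ⟨⟨y, hxy⟩, ?_⟩
  rintro ⟨w, hw⟩
  by_cases hwu : w = u
  · subst hwu; exact hu
  by_cases hwv : w = v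
  · subst hwv; exact hv
  by_cases huw : G.Adj u w
  · exact hu.trans (step hxu hw huw)
  by_cases hvw : G.Adj v w
  · exact hv.trans (step hxv hw hvw)
  exact absurd ⟨x, u, v, w, huv, Ne.symm hwu, Ne.symm hwv, hxu, hxv, hw, hn, huw, hvw⟩ hclaw

theorem Traceable.of_list {V : Type*} {G : SimpleGraph V} {l : List V} (hne : l ≠ [])
    (hchain : l.IsChain G.Adj) (hnodup : l.Nodup) (hmem : ∀ x, x ∈ l) : Traceable G := by
  classical
  refine ⟨_, _, Walk.ofSupport l hne hchain, ?_⟩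
  intro x
  rw [Walk.support_ofSupport]
  convert List.count_eq_one_of_mem hnodup (hmem x)

/-- A graph is traceable if a clique together with a path leading into it covers all vertices. -/
theorem Traceable.of_clique_of_path {V : Type*} {G : SimpleGraph V} {K : Finset V}
    (hK : G.IsClique (K : Set V)) {a : V} {P : List V} (ha : a ∈ K)
    (hP : (P ++ [a]).IsChain G.Adj) (hnodup : P.Nodup) (hdisj : ∀ x ∈ P, x ∉ K)
    (hmem : ∀ x, x ∈ K ∨ x ∈ P) : Traceable G := by
  classical
  refine Traceable.of_list (l := P ++ a :: (K.erase a).toList) (by simp)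
    (List.isChain_split.2 ⟨hP, List.Pairwise.isChain ?_⟩) ?_ ?_
  · have h : (a :: (K.erase a).toList).Nodup := by simp [Finset.nodup_toList]
    refine h.imp_of_mem fun {x y} hx hy hxy => hK ?_ ?_ hxy
    all_goals grind [Finset.mem_toList]
  · grind [Finset.nodup_toList, Finset.mem_toList, List.nodup_append]
  · grind [Finset.mem_toList]

/-- A graph is traceable if a clique together with two disjoint paths leading into it at distinct
vertices covers all vertices. -/
theorem Traceable.of_clique_of_two_paths {V : Type*} {G : SimpleGraph V} {K : Finset V}
    (hK : G.IsClique (K : Set V)) {a b : V} {P Q : List V} (ha : a ∈ K) (hb : b ∈ K) (hab : a ≠ b)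
    (hP : (P ++ [a]).IsChain G.Adj) (hQ : (b :: Q).IsChain G.Adj)
    (hnodup : (P ++ Q).Nodup) (hdisj : ∀ x ∈ P ++ Q, x ∉ K)
    (hmem : ∀ x, x ∈ K ∨ x ∈ P ++ Q) : Traceable G := by
  classical
  refine Traceable.of_list (l := P ++ a :: (((K.erase a).erase b).toList ++ b :: Q)) (by simp)
    (List.isChain_split.2 ⟨hP, ?_⟩) ?_ ?_
  · rw [← List.cons_append]
    refine List.isChain_split.2 ⟨List.Pairwise.isChain ?_, hQ⟩
    have h : (a :: ((K.erase a).erase b).toList ++ [b]).Nodup := by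
      grind [Finset.nodup_toList, Finset.mem_toList, List.nodup_append]
    refine h.imp_of_mem fun {x y} hx hy hxy => hK ?_ ?_ hxy
    all_goals grind [Finset.mem_toList]
  · grind [Finset.nodup_toList, Finset.mem_toList, List.nodup_append]
  · intro x
    have := hmem x
    simp only [List.mem_append, List.mem_cons, Finset.mem_toList, Finset.mem_erase] at this ⊢
    tauto

theorem SimpleGraph.Connected.exists_adj_mem_notMem {V : Type*} {G : SimpleGraph V}
    (hconn : G.Connected) {S : Set V} {u v : V} (hu : u ∈ S) (hv : v ∉ S) :
    ∃ x ∈ S, ∃ y ∉ S, G.Adj x y := by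
  obtain ⟨p⟩ := hconn.preconnected u v
  obtain ⟨d, -, h₁, h₂⟩ := p.exists_boundary_dart S hu hv
  exact ⟨_, h₁, _, h₂, d.adj⟩

theorem SimpleGraph.exists_maximal_clique_card_eq_cliqueNum {V : Type*} [Finite V]
    (G : SimpleGraph V) :
    ∃ K : Finset V, G.IsClique (K : Set V) ∧ K.card = G.cliqueNum ∧
      ∀ p ∉ K, ∃ x ∈ K, ¬ G.Adj p x := by
  classical
  obtain ⟨K, hK⟩ := G.exists_isNClique_cliqueNum
  refine ⟨K, hK.isClique, hK.card_eq, fun p hp => ?_⟩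
  by_contra! h
  have hc : G.IsClique ((insert p K : Finset V) : Set V) := by
    rw [Finset.coe_insert]
    exact hK.isClique.insert fun b hb _ => h b hb
  have := hc.card_le_cliqueNum
  rw [Finset.card_insert_of_notMem hp, hK.card_eq] at this
  omega

section MaximalClique

variable {V : Type*} {G : SimpleGraph V} {K : Finset V}

/-- A vertex outside a maximal clique of a closed claw-free graph has at most one neighbour
in it. -/
theorem IsClosedGraph.eq_of_adj_of_mem_clique (hclosed : IsClosedGraph G) (hclaw : ClawFree G)
    (hK : G.IsClique (K : Set V)) (hmax : ∀ p ∉ K, ∃ x ∈ K, ¬ G.Adj p x)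
    {p a b : V} (hp : p ∉ K) (ha : a ∈ K) (hb : b ∈ K) (hpa : G.Adj p a) (hpb : G.Adj p b) :
    a = b := by
  by_contra hab
  obtain ⟨x, hx, hpx⟩ := hmax p hp
  have hxa : a ≠ x := fun h => hpx (h ▸ hpa)
  have hxb : b ≠ x := fun h => hpx (h ▸ hpb)
  exact hpx (hclosed.adj_of_common_adj hclaw (hK ha hb hab) hpa.symm (hK ha hx hxa) hpb.symm
    (hK hb hx hxb) fun h => hp (h ▸ hx))

/-- Two vertices outside a maximal clique with a common neighbour in it are adjacent. -/
theorem IsClosedGraph.adj_of_adj_of_mem_clique (hclosed : IsClosedGraph G) (hclaw : ClawFree G)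
    (hK : G.IsClique (K : Set V)) (hmax : ∀ p ∉ K, ∃ x ∈ K, ¬ G.Adj p x)
    {p q a : V} (hp : p ∉ K) (hq : q ∉ K) (hpq : p ≠ q) (ha : a ∈ K)
    (hpa : G.Adj p a) (hqa : G.Adj q a) : G.Adj p q := by
  by_contra hn
  obtain ⟨x, hx, hpx⟩ := hmax p hp
  have hax : a ≠ x := fun h => hpx (h ▸ hpa)
  have hqx : ¬ G.Adj q x := fun h =>
    hax (hclosed.eq_of_adj_of_mem_clique hclaw hK hmax hq ha hx hqa h)
  exact hclaw ⟨a, p, q, x, hpq, fun h => hp (h ▸ hx), fun h => hq (h ▸ hx), hpa.symm, hqa.symm,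
    hK ha hx hax, hn, hpx, hqx⟩

/-- With three vertices outside a maximal clique, two of which are adjacent, the graph is
traceable. -/
theorem Traceable.of_clique_of_three_of_adj (hconn : G.Connected) (hclosed : IsClosedGraph G)
    (hclaw : ClawFree G) (hK : G.IsClique (K : Set V)) (hmax : ∀ p ∉ K, ∃ x ∈ K, ¬ G.Adj p x)
    (hne : K.Nonempty) {p q r : V} (hpq : p ≠ q) (hpr : p ≠ r) (hqr : q ≠ r)
    (hmem : ∀ x, x ∉ K ↔ x = p ∨ x = q ∨ x = r) (hadj : G.Adj p q) : Traceable G := by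
  obtain ⟨k, hk⟩ := hne
  have single : ∀ {a x y z : V}, a ∈ K → G.Adj x y → G.Adj y z → G.Adj z a →
      x ≠ z → (∀ w, w ∉ K ↔ w = x ∨ w = y ∨ w = z) → Traceable G := by
    intro a x y z ha hxy hyz hza hxz hm
    have := hxy.ne
    have := hyz.ne
    refine Traceable.of_clique_of_path hK (P := [x, y, z]) ha ?_ ?_ ?_ ?_
    · simp [hxy, hyz, hza]
    all_goals
      simp only [List.nodup_cons, List.mem_cons, List.not_mem_nil, List.nodup_nil]
      grind
  have path : ∀ {x y z : V}, G.Adj x y → G.Adj y z → x ≠ z →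
      (∀ w, w ∉ K ↔ w = x ∨ w = y ∨ w = z) → Traceable G := by
    intro x y z hxy hyz hxz hm
    have hx : x ∉ K := by grind
    have hy : y ∉ K := by grind
    have hz : z ∉ K := by grind
    by_cases h₁ : ∃ a ∈ K, G.Adj z a
    · obtain ⟨a, ha, hza⟩ := h₁
      exact single ha hxy hyz hza hxz hm
    by_cases h₂ : ∃ a ∈ K, G.Adj x a
    · obtain ⟨a, ha, hxa⟩ := h₂
      exact single ha hyz.symm hxy.symm hxa hxz.symm (by grind)
    push Not at h₁ h₂
    obtain ⟨u, hu, a, ha, hua⟩ :=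
      hconn.exists_adj_mem_notMem (S := {w | w ∉ K}) hx (not_not.2 hk)
    have ha' : a ∈ K := not_not.1 ha
    have hya : G.Adj y a := by
      rcases (hm u).1 hu with rfl | rfl | rfl
      · exact absurd hua (h₂ a ha')
      · exact hua
      · exact absurd hua (h₁ a ha')
    by_cases hxz' : G.Adj x z
    · exact single ha' hxz' hyz.symm hya hxy.ne (by grind)
    · exact absurd ⟨y, x, z, a, hxz, by grind, by grind, hxy.symm, hyz, hya, hxz', h₂ a ha',
        h₁ a ha'⟩ hclaw
  by_cases hqr' : G.Adj q r
  · exact path hadj hqr' hpr hmem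
  by_cases hpr' : G.Adj p r
  · exact path hadj.symm hpr' hqr (by grind)
  have hp : p ∉ K := by grind
  have hq : q ∉ K := by grind
  have hr : r ∉ K := by grind
  obtain ⟨u, hu, c, hc, hrc⟩ := hconn.exists_adj_mem_notMem (S := {r}) (v := k) rfl (by grind)
  obtain rfl : u = r := hu
  have hc' : c ∈ K := by
    by_contra hn
    rcases (hmem c).1 hn with rfl | rfl | rfl
    exacts [hpr' hrc.symm, hqr' hrc.symm, hc rfl]
  obtain ⟨v, hv, a, ha, hva⟩ :=
    hconn.exists_adj_mem_notMem (S := {p, q}) (u := p) (v := k) (by simp) (by grind)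
  have two : ∀ {x y : V}, G.Adj x y → G.Adj y a → a ≠ x → x ∉ K → y ∉ K → ¬ G.Adj y u →
      x ≠ u → y ≠ u → (∀ w, w ∉ K ↔ w = x ∨ w = y ∨ w = u) → Traceable G := by
    intro x y hxy hya hax hx hy hyu hxu hyu' hm
    have := hxy.ne
    have ha' : a ∈ K := by
      by_contra hn
      rcases (hm a).1 hn with rfl | rfl | rfl
      exacts [hax rfl, hya.ne rfl, hyu hya]
    have hac : a ≠ c := by
      rintro rfl
      exact hyu (hclosed.adj_of_adj_of_mem_clique hclaw hK hmax hy hr hyu' ha' hya hrc)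
    refine Traceable.of_clique_of_two_paths hK (P := [x, y]) (Q := [u]) ha' hc' hac ?_ ?_ ?_ ?_ ?_
    · simp [hxy, hya]
    · simpa using hrc.symm
    all_goals
      simp only [List.cons_append, List.nil_append, List.nodup_cons, List.mem_cons,
        List.not_mem_nil, List.nodup_nil]
      grind
  rcases hv with rfl | rfl
  · exact two hadj.symm hva (by grind) hq hp hpr' hqr hpr (by grind)
  · exact two hadj hva (by grind) hp hq hqr' hpr hqr hmem

/-- A connected closed claw-free graph with at most two vertices outside a maximal clique is
traceable. -/
theorem Traceable.of_clique_of_card_compl_le_two [Fintype V] [DecidableEq V] (hconn : G.Connected)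
    (hclosed : IsClosedGraph G) (hclaw : ClawFree G) (hK : G.IsClique (K : Set V))
    (hmax : ∀ p ∉ K, ∃ x ∈ K, ¬ G.Adj p x) (hne : K.Nonempty) (hcard : Kᶜ.card ≤ 2) :
    Traceable G := by
  obtain ⟨k, hk⟩ := hne
  have leave : ∀ {S : Set V} {u : V}, u ∈ S → (∀ x ∈ S, x ∉ K) → ∃ x ∈ S, ∃ y ∉ S, G.Adj x y :=
    fun hu hS => hconn.exists_adj_mem_notMem hu fun h => hS k h hk
  interval_cases h : Kᶜ.card
  · have hm : ∀ x, x ∈ K := by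
      intro x
      have := Finset.card_eq_zero.1 h
      have : x ∉ Kᶜ := by simp [this]
      simpa using this
    exact Traceable.of_clique_of_path hK (P := []) hk (by simp) (by simp) (by simp) (by simp [hm])
  · obtain ⟨p, hp⟩ := Finset.card_eq_one.1 h
    have hm : ∀ x, x ∉ K ↔ x = p := fun x => by rw [← Finset.mem_compl, hp, Finset.mem_singleton]
    obtain ⟨u, hu, a, ha, hpa⟩ := leave (S := {p}) rfl (by grind)
    obtain rfl : u = p := hu
    have ha' : a ∈ K := by grind
    refine Traceable.of_clique_of_path hK (P := [u]) ha' (by simpa using hpa) ?_ ?_ ?_ <;> grind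
  · obtain ⟨p, q, hpq, hpq'⟩ := Finset.card_eq_two.1 h
    have hm : ∀ x, x ∉ K ↔ x = p ∨ x = q := fun x => by
      rw [← Finset.mem_compl, hpq', Finset.mem_insert, Finset.mem_singleton]
    have hp : p ∉ K := by grind
    have hq : q ∉ K := by grind
    by_cases hadj : G.Adj p q
    · obtain ⟨u, hu, a, ha, hua⟩ := leave (S := {p, q}) (u := p) (by simp) (by grind)
      have ha' : a ∈ K := by grind
      rcases hu with rfl | rfl
      · refine Traceable.of_clique_of_path hK (P := [q, u]) ha' (by simp [hadj.symm, hua])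
          ?_ ?_ ?_ <;> grind
      · refine Traceable.of_clique_of_path hK (P := [p, u]) ha' (by simp [hadj, hua])
          ?_ ?_ ?_ <;> grind
    · obtain ⟨u, hu, a, ha, hua⟩ := leave (S := {p}) rfl (by grind)
      obtain rfl : u = p := hu
      obtain ⟨v, hv, b, hb, hvb⟩ := leave (S := {q}) rfl (by grind)
      obtain rfl : v = q := hv
      have ha' : a ∈ K := by
        by_contra hn
        rcases (hm a).1 hn with rfl | rfl
        exacts [ha rfl, hadj hua]
      have hb' : b ∈ K := by
        by_contra hn
        rcases (hm b).1 hn with rfl | rfl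
        exacts [hadj hvb.symm, hb rfl]
      have hab : a ≠ b := by
        rintro rfl
        exact hadj (hclosed.adj_of_adj_of_mem_clique hclaw hK hmax hp hq hpq ha' hua hvb)
      refine Traceable.of_clique_of_two_paths hK (P := [u]) (Q := [v]) ha' hb' hab
        (by simpa using hua) (by simpa using hvb.symm) ?_ ?_ ?_ <;> grind

/-- A clique together with three pendant vertices attached at distinct clique vertices is
isomorphic to `EN n`. -/
theorem nonempty_iso_ENgraph_s6 [Fintype V] {n : ℕ} (hcard : Fintype.card V = n)
    (hK : G.IsClique (K : Set V)) {a b c p q r : V} (ha : a ∈ K) (hb : b ∈ K) (hc : c ∈ K)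
    (hab : a ≠ b) (hac : a ≠ c) (hbc : b ≠ c) (hpq : p ≠ q) (hpr : p ≠ r) (hqr : q ≠ r)
    (hmem : ∀ x, x ∉ K ↔ x = p ∨ x = q ∨ x = r)
    (hp : ∀ x, G.Adj p x ↔ x = a) (hq : ∀ x, G.Adj q x ↔ x = b) (hr : ∀ x, G.Adj r x ↔ x = c) :
    Nonempty (G ≃g ENgraph n) := by
  classical
  obtain ⟨L, hL⟩ : ∃ L, L = a :: b :: c :: (((K.erase a).erase b).erase c).toList := ⟨_, rfl⟩
  have hLmem : ∀ x, x ∈ L ↔ x ∈ K := by grind [Finset.mem_toList]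
  have hLnd : L.Nodup := by grind [Finset.nodup_toList, Finset.mem_toList]
  have hnd : (L ++ [p, q, r]).Nodup := by grind [List.nodup_append]
  have hall : ∀ x, x ∈ L ++ [p, q, r] := by
    intro x
    by_cases hx : x ∈ K <;> grind
  let e := hnd.getEquivOfForallMemList _ hall
  have hlen : L.length + 3 = n := by
    rw [← hcard, ← Fintype.card_congr e]
    simp
  obtain rfl := hlen
  have hL3 : 3 ≤ L.length := by simp [hL]
  let f : Fin (L.length + 3) ≃ V := (finCongr (by simp)).trans e
  have hf : ∀ i, f i = (L ++ [p, q, r])[i.val]'(by simp) := fun i => rfl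
  have hlow : ∀ i : Fin (L.length + 3), i.val < L.length → f i ∈ K := by
    intro i hi
    rw [hf, List.getElem_append_left hi, ← hLmem]
    exact List.getElem_mem _
  have h0 : f ⟨0, by omega⟩ = a := by simp [hf, hL]
  have h1 : f ⟨1, by omega⟩ = b := by simp [hf, hL]
  have h2 : f ⟨2, by omega⟩ = c := by simp [hf, hL]
  have g0 : f ⟨L.length, by omega⟩ = p := by simp [hf]
  have g1 : f ⟨L.length + 1, by omega⟩ = q := by simp [hf]
  have g2 : f ⟨L.length + 2, by omega⟩ = r := by simp [hf]
  have high : ∀ i j : Fin (L.length + 3), L.length ≤ i.val →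
      (G.Adj (f i) (f j) ↔ i.val = j.val + L.length) := by
    intro i j hi
    have hi' : i = ⟨L.length, by omega⟩ ∨ i = ⟨L.length + 1, by omega⟩ ∨
        i = ⟨L.length + 2, by omega⟩ := by
      simp only [Fin.ext_iff]
      omega
    rcases hi' with hi' | hi' | hi'
    · rw [hi', g0, hp, ← h0, f.injective.eq_iff, Fin.ext_iff]
      simp only
      omega
    · rw [hi', g1, hq, ← h1, f.injective.eq_iff, Fin.ext_iff]
      simp only
      omega
    · rw [hi', g2, hr, ← h2, f.injective.eq_iff, Fin.ext_iff]
      simp only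
      omega
  refine ⟨RelIso.symm ⟨f, ?_⟩⟩
  intro i j
  simp only [ENgraph, fromRel_adj, Nat.add_sub_cancel, ne_eq, Fin.ext_iff]
  by_cases hi : L.length ≤ i.val
  · rw [high i j hi]
    omega
  by_cases hj : L.length ≤ j.val
  · rw [G.adj_comm, high j i hj]
    omega
  have hadj : G.Adj (f i) (f j) ↔ i.val ≠ j.val := by
    refine ⟨fun h hij => h.ne (congrArg f (Fin.ext hij)), fun h => ?_⟩
    exact hK (hlow i (by omega)) (hlow j (by omega)) fun h' => h (congrArg _ (f.injective h'))
  rw [hadj]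
  omega

end MaximalClique

theorem statement_6 {V : Type*} [Fintype V] (G : SimpleGraph V) (n : ℕ)
    (hcard : Fintype.card V = n)
    (hconn : G.Connected) (hclosed : IsClosedGraph G) (hclaw : ClawFree G)
    (htr : ¬ Traceable G) (hclique : G.cliqueNum ≥ n - 3) :
    Nonempty (G ≃g ENgraph n) := by
  classical
  obtain ⟨K, hK, hKcard, hmax⟩ := G.exists_maximal_clique_card_eq_cliqueNum
  have hne : K.Nonempty := by
    obtain ⟨v⟩ := hconn.nonempty
    by_contra h
    rw [Finset.not_nonempty_iff_eq_empty] at h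
    subst h
    obtain ⟨x, hx, -⟩ := hmax v (by simp)
    simp at hx
  have hcompl : Kᶜ.card = 3 := by
    have h₁ := K.card_add_card_compl
    have h₂ : ¬ Kᶜ.card ≤ 2 := fun h =>
      htr (Traceable.of_clique_of_card_compl_le_two hconn hclosed hclaw hK hmax hne h)
    omega
  obtain ⟨p, q, r, hpq, hpr, hqr, hpqr⟩ := Finset.card_eq_three.1 hcompl
  have hm : ∀ x, x ∉ K ↔ x = p ∨ x = q ∨ x = r := fun x => by
    rw [← Finset.mem_compl, hpqr]
    simp
  have indep : ∀ x y, x ∉ K → y ∉ K → ¬ G.Adj x y := by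
    intro x y hx hy hxy
    have hne' := hxy.ne
    obtain ⟨z, hz⟩ : ∃ z, z ≠ x ∧ z ≠ y ∧ ∀ w, w ∉ K ↔ w = x ∨ w = y ∨ w = z := by
      rcases (hm x).1 hx with rfl | rfl | rfl <;> rcases (hm y).1 hy with rfl | rfl | rfl
      · exact absurd rfl hne'
      · exact ⟨r, by grind⟩
      · exact ⟨q, by grind⟩
      · exact ⟨r, by grind⟩
      · exact absurd rfl hne'
      · exact ⟨p, by grind⟩
      · exact ⟨q, by grind⟩
      · exact ⟨p, by grind⟩
      · exact absurd rfl hne'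
    exact htr (Traceable.of_clique_of_three_of_adj hconn hclosed hclaw hK hmax hne hne'
      hz.1.symm hz.2.1.symm hz.2.2 hxy)
  have att : ∀ x, x ∉ K → ∃ a ∈ K, ∀ y, G.Adj x y ↔ y = a := by
    intro x hx
    obtain ⟨k, hk⟩ := hne
    obtain ⟨u, hu, a, -, hxa⟩ :=
      hconn.exists_adj_mem_notMem (S := {x}) (v := k) rfl fun h => hx (h ▸ hk)
    obtain rfl : u = x := hu
    have ha : a ∈ K := by_contra fun h => indep u a hx h hxa
    refine ⟨a, ha, fun y => ⟨fun hy => ?_, fun hy => hy ▸ hxa⟩⟩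
    have hyK : y ∈ K := by_contra fun h => indep u y hx h hy
    exact hclosed.eq_of_adj_of_mem_clique hclaw hK hmax hx hyK ha hy hxa
  have hp : p ∉ K := by simp [hm]
  have hq : q ∉ K := by simp [hm]
  have hr : r ∉ K := by simp [hm]
  obtain ⟨a, ha, hpa⟩ := att p hp
  obtain ⟨b, hb, hqb⟩ := att q hq
  obtain ⟨c, hc, hrc⟩ := att r hr
  have dist : ∀ {x y s t : V}, x ∉ K → y ∉ K → x ≠ y → s ∈ K →
      (∀ z, G.Adj x z ↔ z = s) → (∀ z, G.Adj y z ↔ z = t) → s ≠ t := by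
    rintro x y s t hx hy hxy hs hxs hyt rfl
    exact indep x y hx hy (hclosed.adj_of_adj_of_mem_clique hclaw hK hmax hx hy hxy hs
      ((hxs s).2 rfl) ((hyt s).2 rfl))
  exact nonempty_iso_ENgraph_s6 hcard hK ha hb hc (dist hp hq hpq ha hpa hqb)
    (dist hp hr hpr ha hpa hrc) (dist hq hr hqr hb hqb hrc) hpq hpr hqr hm hpa hqb hrc
end
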